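/- arXiv:2311.03728 — 3 statements merged into one kernel-verified Lean document; each statement's English description precedes it below -/
import Mathlib

section
/- (Theorem 2.1, main theorem) Under assumptions (A1)–(A3) there exist ε₀ > 0 and 0 < r₀ < r₁ such that for every ω ∈ [0,1] and every ε ∈ (−ε₀,ε₀) there exists a unique C¹ function φ_{ω,ε} : ℝ^{k₁} → r₀𝔻^{k₂} satisfying: (C1) f_{ω,ε}(graph(φ_{ω,ε})) = graph(φ_{ω,ε}), where graph(φ_{ω,ε}) = {(x,φ_{ω,ε}(x)) : x ∈ ℝ^{k₁}}; and (C2) every trajectory (x_j,y_j)_{j≥0} of f_{ω,ε} with initial condition (x₀,y₀) ∈ ℝ^{k₁}×r₀𝔻^{k₂} is defined for all j ∈ ℕ and ‖y_j − φ_{ω,ε}(x_j)‖ → 0 as j → ∞, uniformly with respect to the initial condition (x₀,y₀). Moreover (C3) φ_{ω,ε} depends continuously on (ω,ε) ∈ [0,1]×(−ε₀,ε₀), and φ_{ω,0} ≡ 0; in particular x ↦ φ_{ω,ε}(x) is bounded on ℝ^{k₁}. -/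
open Set

abbrev Euc (k : ℕ) : Type := EuclideanSpace ℝ (Fin k)

/-- The map `f_{ω,ε}(x,y) = (x + ω·α(ω,ε,x,y), β(ω,ε,x,y))`. -/
noncomputable def fmap {k₁ k₂ : ℕ} (α : ℝ → ℝ → Euc k₁ → Euc k₂ → Euc k₁)
    (β : ℝ → ℝ → Euc k₁ → Euc k₂ → Euc k₂) (ω ε : ℝ)
    (p : Euc k₁ × Euc k₂) : Euc k₁ × Euc k₂ :=
  (p.1 + ω • α ω ε p.1 p.2, β ω ε p.1 p.2)

/-- `f(graph φ) = graph φ`. -/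
def fInv {k₁ k₂ : ℕ} (f : Euc k₁ × Euc k₂ → Euc k₁ × Euc k₂)
    (φ : Euc k₁ → Euc k₂) : Prop :=
  f '' {p : Euc k₁ × Euc k₂ | p.2 = φ p.1} = {p : Euc k₁ × Euc k₂ | p.2 = φ p.1}

/-- Every trajectory starting in `ℝ^{k₁} × r₀𝔻` is defined for all times (stays in the
`r₁`-ball in the `y`-component) and `‖y_j - φ(x_j)‖ → 0` uniformly in the initial condition. -/
def fAttr {k₁ k₂ : ℕ} (f : Euc k₁ × Euc k₂ → Euc k₁ × Euc k₂) (r₀ r₁ : ℝ)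
    (φ : Euc k₁ → Euc k₂) : Prop :=
  (∀ z₀ : Euc k₁ × Euc k₂, ‖z₀.2‖ ≤ r₀ → ∀ j : ℕ, ‖(f^[j] z₀).2‖ ≤ r₁) ∧
  ∀ δ : ℝ, 0 < δ → ∃ N : ℕ, ∀ z₀ : Euc k₁ × Euc k₂, ‖z₀.2‖ ≤ r₀ →
    ∀ j : ℕ, N ≤ j → ‖(f^[j] z₀).2 - φ (f^[j] z₀).1‖ ≤ δ

section Abstract

variable {X Y Z : Type*} [NormedAddCommGroup X] [NormedSpace ℝ X]
  [NormedAddCommGroup Y] [NormedSpace ℝ Y] [NormedAddCommGroup Z] [NormedSpace ℝ Z]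

structure GoodF (a : X × Y → X) (b : X × Y → Y) (r η A q M : ℝ) : Prop where
  da : Differentiable ℝ a
  db : Differentiable ℝ b
  a1 : ∀ x y, ‖y‖ ≤ r → ∀ u v, ‖fderiv ℝ a (x, y) (u, v)‖ ≤ η * ‖u‖ + A * ‖v‖
  b1 : ∀ x y, ‖y‖ ≤ r → ∀ u v, ‖fderiv ℝ b (x, y) (u, v)‖ ≤ η * ‖u‖ + q * ‖v‖
  a2 : ∀ x y x' y', ‖y‖ ≤ r → ‖y'‖ ≤ r →
    ‖fderiv ℝ a (x, y) - fderiv ℝ a (x', y')‖ ≤ M * (‖x - x'‖ + ‖y - y'‖)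
  b2 : ∀ x y x' y', ‖y‖ ≤ r → ‖y'‖ ≤ r →
    ‖fderiv ℝ b (x, y) - fderiv ℝ b (x', y')‖ ≤ M * (‖x - x'‖ + ‖y - y'‖)
  b0 : ∀ x y, ‖y‖ ≤ r → ‖b (x, y)‖ ≤ r

structure GoodC (η A q M L K θ : ℝ) : Prop where
  η0 : 0 ≤ η
  A0 : 0 ≤ A
  q0 : 0 ≤ q
  M0 : 0 ≤ M
  L0 : 0 ≤ L
  K0 : 0 ≤ K
  θ1 : θ < 1
  c1 : η + A * L ≤ θ
  c2 : η + q * L ≤ L * (1 - θ)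
  c3 : q + L * A < 1
  c4 : M * (1 + L) ^ 3 + (q + L * A) * K ≤ K * (1 - θ) ^ 2

structure GoodG (φ : X → Y) (r L K : ℝ) : Prop where
  d : Differentiable ℝ φ
  b : ∀ x, ‖φ x‖ ≤ r
  l : ∀ x, ‖fderiv ℝ φ x‖ ≤ L
  k : ∀ x x', ‖fderiv ℝ φ x - fderiv ℝ φ x'‖ ≤ K * ‖x - x'‖

lemma lip_of_dir {c : X × Y → Z} {r s t : ℝ} (dc : Differentiable ℝ c)
    (c1 : ∀ x y, ‖y‖ ≤ r → ∀ u v, ‖fderiv ℝ c (x, y) (u, v)‖ ≤ s * ‖u‖ + t * ‖v‖)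
    (x x' : X) (y y' : Y) (hy : ‖y‖ ≤ r) (hy' : ‖y'‖ ≤ r) :
    ‖c (x, y) - c (x', y')‖ ≤ s * ‖x - x'‖ + t * ‖y - y'‖ := by
  have key := norm_image_sub_le_of_norm_deriv_le_segment_01'
    (f := fun τ : ℝ => c ((x', y') + τ • (x - x', y - y')))
    (f' := fun τ : ℝ => fderiv ℝ c ((x', y') + τ • (x - x', y - y')) (x - x', y - y'))
    (C := s * ‖x - x'‖ + t * ‖y - y'‖) ?_ ?_
  · simpa using key
  · intro τ _
    apply HasDerivAt.hasDerivWithinAt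
    have h1 : HasDerivAt (fun τ : ℝ => (x', y') + τ • (x - x', y - y')) (x - x', y - y') τ := by
      simpa using ((hasDerivAt_id τ).smul_const (x - x', y - y')).const_add (x', y')
    exact (dc _).hasFDerivAt.comp_hasDerivAt τ h1
  · intro τ hτ
    apply c1
    have := (convex_closedBall (0 : Y) r) (x := y') (by simpa using hy') (y := y)
      (by simpa using hy) (a := 1 - τ) (b := τ) (by linarith [hτ.2]) hτ.1 (by ring)
    have e : y' + τ • (y - y') = (1 - τ) • y' + τ • y := by module
    simpa [e] using this

lemma GoodG.lip {φ : X → Y} {r L K : ℝ} (h : GoodG φ r L K) (x x' : X) :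
    ‖φ x - φ x'‖ ≤ L * ‖x - x'‖ :=
  convex_univ.norm_image_sub_le_of_norm_fderiv_le (fun x _ => h.d x) (fun x _ => h.l x)
    (mem_univ _) (mem_univ _)

lemma norm_pair_le (u : X) (T : X →L[ℝ] Y) {L : ℝ} (hL : 0 ≤ L) (hT : ‖T‖ ≤ L) :
    ‖((u, T u) : X × Y)‖ ≤ (1 + L) * ‖u‖ := by
  have h1 : ‖T u‖ ≤ L * ‖u‖ := T.le_of_opNorm_le hT u
  have := norm_nonneg u
  have : 0 ≤ L * ‖u‖ := by positivity
  simp only [Prod.norm_mk]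
  apply max_le <;> nlinarith

/-- derivative of `x ↦ c (x, φ x)` varies in a Lipschitz manner -/
lemma comp_lip {c : X × Y → Z} {φ : X → Y} {r s t M L K : ℝ} (hM : 0 ≤ M) (hL : 0 ≤ L)
    (ht : 0 ≤ t)
    (c1 : ∀ x y, ‖y‖ ≤ r → ∀ u v, ‖fderiv ℝ c (x, y) (u, v)‖ ≤ s * ‖u‖ + t * ‖v‖)
    (c2 : ∀ x y x' y', ‖y‖ ≤ r → ‖y'‖ ≤ r →
      ‖fderiv ℝ c (x, y) - fderiv ℝ c (x', y')‖ ≤ M * (‖x - x'‖ + ‖y - y'‖))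
    (hφ : GoodG φ r L K) (x x' u : X) :
    ‖fderiv ℝ c (x, φ x) (u, fderiv ℝ φ x u) - fderiv ℝ c (x', φ x') (u, fderiv ℝ φ x' u)‖
      ≤ (M * (1 + L) ^ 2 + t * K) * ‖x - x'‖ * ‖u‖ := by
  have e : fderiv ℝ c (x, φ x) (u, fderiv ℝ φ x u) - fderiv ℝ c (x', φ x') (u, fderiv ℝ φ x' u)
      = (fderiv ℝ c (x, φ x) - fderiv ℝ c (x', φ x')) (u, fderiv ℝ φ x u)
        + fderiv ℝ c (x', φ x') (0, (fderiv ℝ φ x - fderiv ℝ φ x') u) := by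
    have : ((0, (fderiv ℝ φ x - fderiv ℝ φ x') u) : X × Y)
        = (u, fderiv ℝ φ x u) - (u, fderiv ℝ φ x' u) := by simp
    rw [this, map_sub]; simp
  rw [e]
  have h1 : ‖(fderiv ℝ c (x, φ x) - fderiv ℝ c (x', φ x')) (u, fderiv ℝ φ x u)‖
      ≤ (M * ((1 + L) * ‖x - x'‖)) * ((1 + L) * ‖u‖) := by
    refine (ContinuousLinearMap.le_opNorm _ _).trans ?_
    refine mul_le_mul ((c2 _ _ _ _ (hφ.b _) (hφ.b _)).trans ?_)
      (norm_pair_le u _ hL (hφ.l x)) (norm_nonneg _) (by positivity)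
    gcongr
    linarith [hφ.lip x x']
  have h2 : ‖fderiv ℝ c (x', φ x') (0, (fderiv ℝ φ x - fderiv ℝ φ x') u)‖
      ≤ t * ((K * ‖x - x'‖) * ‖u‖) := by
    refine (c1 _ _ (hφ.b _) _ _).trans ?_
    simp only [norm_zero, mul_zero, zero_add]
    gcongr
    exact ContinuousLinearMap.le_of_opNorm_le _ (hφ.k x x') u
  refine (norm_add_le _ _).trans ((add_le_add h1 h2).trans (le_of_eq ?_))
  ring

lemma hasFDerivAt_comp_graph {c : X × Y → Z} {φ : X → Y} (dc : Differentiable ℝ c)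
    (dφ : Differentiable ℝ φ) (x : X) :
    HasFDerivAt (fun x => c (x, φ x))
      ((fderiv ℝ c (x, φ x)).comp ((ContinuousLinearMap.id ℝ X).prod (fderiv ℝ φ x))) x :=
  (dc (x, φ x)).hasFDerivAt.comp x ((hasFDerivAt_id x).prodMk (dφ x).hasFDerivAt)

variable [CompleteSpace X]

lemma graph_transform {a : X × Y → X} {b : X × Y → Y} {r η A q M L K θ : ℝ}
    (hf : GoodF a b r η A q M) (hc : GoodC η A q M L K θ) {φ : X → Y} (hφ : GoodG φ r L K) :
    Function.Surjective (fun x => x + a (x, φ x)) ∧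
    ∃ ψ : X → Y, GoodG ψ r L K ∧ ∀ x, ψ (x + a (x, φ x)) = b (x, φ x) := by
  obtain ⟨η0, A0, q0, M0, L0, K0, θ1, c1, c2, c3, c4⟩ := hc
  have hθ0 : 0 ≤ θ := le_trans (by positivity) c1
  set T : X → X →L[ℝ] X := fun x =>
    (fderiv ℝ a (x, φ x)).comp ((ContinuousLinearMap.id ℝ X).prod (fderiv ℝ φ x)) with hT
  set h : X → X := fun x => x + a (x, φ x) with hh
  have hTn : ∀ x, ‖T x‖ ≤ θ := by
    intro x
    refine ContinuousLinearMap.opNorm_le_bound _ hθ0 fun u => ?_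
    have h1 := hf.a1 x (φ x) (hφ.b x) u (fderiv ℝ φ x u)
    have h2 : ‖fderiv ℝ φ x u‖ ≤ L * ‖u‖ := ContinuousLinearMap.le_of_opNorm_le _ (hφ.l x) u
    have h3 : A * ‖fderiv ℝ φ x u‖ ≤ A * (L * ‖u‖) := by gcongr
    have h4 : (η + A * L) * ‖u‖ ≤ θ * ‖u‖ := by gcongr
    change ‖fderiv ℝ a (x, φ x) (u, fderiv ℝ φ x u)‖ ≤ _
    linarith
  have hTd : ∀ x, HasFDerivAt (fun x => a (x, φ x)) (T x) x := fun x =>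
    hasFDerivAt_comp_graph hf.da hφ.d x
  have hlip : ∀ x x', ‖a (x, φ x) - a (x', φ x')‖ ≤ θ * ‖x - x'‖ := fun x x' =>
    convex_univ.norm_image_sub_le_of_norm_hasFDerivWithin_le
      (fun x _ => (hTd x).hasFDerivWithinAt) (fun x _ => hTn x) (mem_univ _) (mem_univ _)
  have happ : ApproximatesLinearOn h ((ContinuousLinearEquiv.refl ℝ X : X ≃L[ℝ] X) : X →L[ℝ] X)
      univ ⟨θ, hθ0⟩ := by
    intro x _ x' _
    have : h x - h x' - ((ContinuousLinearEquiv.refl ℝ X : X ≃L[ℝ] X) : X →L[ℝ] X) (x - x')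
      = a (x, φ x) - a (x', φ x') := by
      simp [hh]; abel
    rw [this]
    exact hlip x x'
  have hcond : Subsingleton X ∨ (⟨θ, hθ0⟩ : NNReal) <
      ‖((ContinuousLinearEquiv.refl ℝ X : X ≃L[ℝ] X).symm : X →L[ℝ] X)‖₊⁻¹ := by
    rcases subsingleton_or_nontrivial X with hs | hs
    · exact Or.inl hs
    · right
      have : ‖((ContinuousLinearEquiv.refl ℝ X : X ≃L[ℝ] X).symm : X →L[ℝ] X)‖₊ = 1 := by
        ext
        exact ContinuousLinearMap.norm_id
      rw [this, inv_one]
      exact_mod_cast θ1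
  have hHh : ∃ H : X ≃ₜ X, ∀ x, H x = h x := ⟨happ.toHomeomorph h hcond, fun _ => rfl⟩
  obtain ⟨H, hH⟩ := hHh
  have hsurj : Function.Surjective h := fun x => ⟨H.symm x, by rw [← hH]; simp⟩
  have hhd : ∀ x, HasFDerivAt h (ContinuousLinearMap.id ℝ X + T x) x := fun x =>
    (hasFDerivAt_id x).add (hTd x)
  have hE : ∀ x, ∃ E : X ≃L[ℝ] X, (E : X →L[ℝ] X) = ContinuousLinearMap.id ℝ X + T x := by
    intro x
    refine ⟨ContinuousLinearEquiv.unitsEquiv ℝ X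
      (Units.oneSub (-(T x)) (by rw [norm_neg]; exact (hTn x).trans_lt θ1)), ?_⟩
    ext u
    simp
  choose E hE using hE
  have hEl : ∀ x u, (1 - θ) * ‖u‖ ≤ ‖E x u‖ := by
    intro x u
    have e1 : E x u = u + T x u := by
      have := congrArg (fun S : X →L[ℝ] X => S u) (hE x)
      simpa using this
    have h1 : ‖T x u‖ ≤ θ * ‖u‖ := ContinuousLinearMap.le_of_opNorm_le _ (hTn x) u
    have h2 : ‖u‖ ≤ ‖u + T x u‖ + ‖T x u‖ := by
      simpa using norm_sub_le (u + T x u) (T x u)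
    rw [e1]; linarith
  have hHsd : ∀ x, HasFDerivAt H.symm ((E (H.symm x)).symm : X →L[ℝ] X) x := by
    intro x
    refine HasFDerivAt.of_local_left_inverse (f := h) H.symm.continuous.continuousAt ?_ ?_
    · rw [hE]; exact hhd _
    · exact Filter.Eventually.of_forall fun y => by rw [← hH]; simp
  refine ⟨hsurj, fun x => b (H.symm x, φ (H.symm x)), ?_, ?_⟩
  swap
  · intro x
    have : H.symm (x + a (x, φ x)) = x := by
      change H.symm (h x) = x
      rw [← hH]; simp
    simp only [this]
  set ψ : X → Y := fun x => b (H.symm x, φ (H.symm x)) with hψ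
  have hHsd' : Differentiable ℝ H.symm := fun x => (hHsd x).differentiableAt
  have hψd : Differentiable ℝ ψ :=
    hf.db.comp (hHsd'.prodMk (hφ.d.comp hHsd'))
  -- the fundamental derivative identity
  have hP : ∀ x u, fderiv ℝ ψ (h x) (E x u) = fderiv ℝ b (x, φ x) (u, fderiv ℝ φ x u) := by
    intro x u
    have e1 : HasFDerivAt (fun x => ψ (h x)) ((fderiv ℝ ψ (h x)).comp (E x : X →L[ℝ] X)) x := by
      have := hhd x
      rw [← hE] at this
      exact (hψd (h x)).hasFDerivAt.comp x this
    have e2 : (fun x => ψ (h x)) = fun x => b (x, φ x) := by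
      funext x
      simp only [hψ, ← hH, Homeomorph.symm_apply_apply]
    rw [e2] at e1
    have := e1.unique (hasFDerivAt_comp_graph hf.db hφ.d x)
    exact congrArg (fun S : X →L[ℝ] Y => S u) this
  have h1θ : 0 < 1 - θ := by linarith
  have hPl : ∀ x, ‖fderiv ℝ ψ x‖ ≤ L := by
    intro x'
    obtain ⟨x, rfl⟩ := hsurj x'
    refine ContinuousLinearMap.opNorm_le_bound _ L0 fun w => ?_
    obtain ⟨u, rfl⟩ := (E x).surjective w
    rw [hP]
    have h1 := hf.b1 x (φ x) (hφ.b x) u (fderiv ℝ φ x u)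
    have h2 : ‖fderiv ℝ φ x u‖ ≤ L * ‖u‖ := ContinuousLinearMap.le_of_opNorm_le _ (hφ.l x) u
    have h3 : q * ‖fderiv ℝ φ x u‖ ≤ q * (L * ‖u‖) := by gcongr
    have h4 : (η + q * L) * ‖u‖ ≤ (L * (1 - θ)) * ‖u‖ := by gcongr
    have h5 : L * ((1 - θ) * ‖u‖) ≤ L * ‖E x u‖ := by gcongr; exact hEl x u
    linarith
  refine ⟨hψd, fun x => hf.b0 _ _ (hφ.b _), hPl, ?_⟩
  intro x1' x2'
  obtain ⟨x1, rfl⟩ := hsurj x1'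
  obtain ⟨x2, rfl⟩ := hsurj x2'
  refine ContinuousLinearMap.opNorm_le_bound _ (by positivity) fun w => ?_
  obtain ⟨u, rfl⟩ := (E x1).surjective w
  have hd : (1 - θ) * ‖x1 - x2‖ ≤ ‖h x1 - h x2‖ := by
    have h1 := hlip x1 x2
    have h2 : ‖x1 - x2‖ ≤ ‖h x1 - h x2‖ + ‖a (x1, φ x1) - a (x2, φ x2)‖ := by
      have := norm_sub_le (h x1 - h x2) (a (x1, φ x1) - a (x2, φ x2))
      have e : h x1 - h x2 - (a (x1, φ x1) - a (x2, φ x2)) = x1 - x2 := by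
        simp only [hh]; abel
      rwa [e] at this
    linarith
  have hu := hEl x1 u
  have hEe : E x1 u - E x2 u = fderiv ℝ a (x1, φ x1) (u, fderiv ℝ φ x1 u)
      - fderiv ℝ a (x2, φ x2) (u, fderiv ℝ φ x2 u) := by
    have e1 : ∀ x, E x u = u + fderiv ℝ a (x, φ x) (u, fderiv ℝ φ x u) := by
      intro x
      have := congrArg (fun S : X →L[ℝ] X => S u) (hE x)
      simpa [hT] using this
    rw [e1, e1]; abel
  have e3 : (fderiv ℝ ψ (h x1) - fderiv ℝ ψ (h x2)) (E x1 u)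
      = (fderiv ℝ b (x1, φ x1) (u, fderiv ℝ φ x1 u) - fderiv ℝ b (x2, φ x2) (u, fderiv ℝ φ x2 u))
        - fderiv ℝ ψ (h x2) (E x1 u - E x2 u) := by
    rw [← hP, ← hP]; simp
  rw [e3]
  have n1 := comp_lip M0 L0 q0 hf.b1 hf.b2 hφ x1 x2 u
  have n2 := comp_lip M0 L0 A0 hf.a1 hf.a2 hφ x1 x2 u
  have n3 : ‖fderiv ℝ ψ (h x2) (E x1 u - E x2 u)‖
      ≤ L * ((M * (1 + L) ^ 2 + A * K) * ‖x1 - x2‖ * ‖u‖) := by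
    refine (ContinuousLinearMap.le_of_opNorm_le _ (hPl (h x2)) _).trans ?_
    rw [hEe]
    gcongr
  refine (norm_sub_le _ _).trans ((add_le_add n1 n3).trans ?_)
  have n4 : ((1 - θ) * ‖x1 - x2‖) * ((1 - θ) * ‖u‖) ≤ ‖h x1 - h x2‖ * ‖E x1 u‖ := by
    gcongr
  have n5 : (M * (1 + L) ^ 3 + (q + L * A) * K) * (‖x1 - x2‖ * ‖u‖)
      ≤ (K * (1 - θ) ^ 2) * (‖x1 - x2‖ * ‖u‖) := by gcongr
  have n6 := mul_le_mul_of_nonneg_left n4 K0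
  calc _ = (M * (1 + L) ^ 3 + (q + L * A) * K) * (‖x1 - x2‖ * ‖u‖) := by ring
    _ ≤ _ := n5
    _ = K * (((1 - θ) * ‖x1 - x2‖) * ((1 - θ) * ‖u‖)) := by ring
    _ ≤ _ := n6
    _ = _ := by ring


omit [CompleteSpace X] in
lemma taylor_bound {φ : X → Y} {r L K : ℝ} (hK : 0 ≤ K) (hφ : GoodG φ r L K) (x h : X) :
    ‖φ (x + h) - φ x - fderiv ℝ φ x h‖ ≤ K * ‖h‖ * ‖h‖ := by
  have := (convex_closedBall x ‖h‖).norm_image_sub_le_of_norm_fderiv_le' (𝕜 := ℝ) (f := φ)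
    (C := K * ‖h‖) (φ := fderiv ℝ φ x) (x := x) (y := x + h) (fun z _ => hφ.d z)
    (fun z hz => (hφ.k z x).trans (by
      have : ‖z - x‖ ≤ ‖h‖ := by simpa [dist_eq_norm] using hz
      gcongr)) (by simp) (by simp)
  simpa using this

omit [CompleteSpace X] in
lemma interp {φ ψ : X → Y} {r L K δ t : ℝ} (hK : 0 ≤ K) (hφ : GoodG φ r L K)
    (hψ : GoodG ψ r L K) (ht : 0 < t) (hδ : ∀ x, ‖φ x - ψ x‖ ≤ δ) (x : X) :
    ‖fderiv ℝ φ x - fderiv ℝ ψ x‖ ≤ 2 * δ / t + 2 * K * t := by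
  have hδ0 : 0 ≤ δ := (norm_nonneg _).trans (hδ x)
  refine ContinuousLinearMap.opNorm_le_of_unit_norm (by positivity) fun w hw => ?_
  have h1 := taylor_bound hK hφ x (t • w)
  have h2 := taylor_bound hK hψ x (t • w)
  have hn : ‖t • w‖ = t := by rw [norm_smul, hw, mul_one, Real.norm_of_nonneg ht.le]
  rw [hn] at h1 h2
  have e : t • ((fderiv ℝ φ x - fderiv ℝ ψ x) w)
      = (φ (x + t • w) - ψ (x + t • w)) - (φ x - ψ x)
        - (φ (x + t • w) - φ x - fderiv ℝ φ x (t • w))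
        + (ψ (x + t • w) - ψ x - fderiv ℝ ψ x (t • w)) := by
    simp only [map_smul, sub_apply, smul_sub]; abel
  have h3 : t * ‖(fderiv ℝ φ x - fderiv ℝ ψ x) w‖ ≤ δ + δ + K * t * t + K * t * t := by
    have e2 : t * ‖(fderiv ℝ φ x - fderiv ℝ ψ x) w‖ = ‖t • ((fderiv ℝ φ x - fderiv ℝ ψ x) w)‖ := by
      rw [norm_smul, Real.norm_of_nonneg ht.le]
    rw [e2, e]
    refine (norm_add_le _ _).trans (add_le_add ((norm_sub_le _ _).trans
      (add_le_add ((norm_sub_le _ _).trans (add_le_add (hδ _) (hδ _))) h1)) h2)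
  have e4 : 2 * δ / t + 2 * K * t = (δ + δ + K * t * t + K * t * t) / t := by
    field_simp; ring
  rw [e4, le_div_iff₀ ht]
  linarith

omit [CompleteSpace X] in
lemma goodG_limit [CompleteSpace Y] {φ : ℕ → X → Y} {ψ : X → Y} {r L K : ℝ} (hK : 0 ≤ K)
    (hφ : ∀ n, GoodG (φ n) r L K) (hlim : TendstoUniformly φ ψ Filter.atTop) :
    GoodG ψ r L K := by
  have hcau : UniformCauchySeqOn (fun n => fderiv ℝ (φ n)) Filter.atTop univ := by
    rw [Metric.uniformCauchySeqOn_iff]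
    intro e he
    set t := e / (8 * (K + 1)) with ht
    have ht0 : 0 < t := by positivity
    have hu : UniformCauchySeqOn φ Filter.atTop univ :=
      (tendstoUniformlyOn_univ.2 hlim).uniformCauchySeqOn
    rw [Metric.uniformCauchySeqOn_iff] at hu
    obtain ⟨N, hN⟩ := hu (e * t / 8) (by positivity)
    refine ⟨N, fun m hm n hn x _ => ?_⟩
    rw [dist_eq_norm]
    have := interp hK (hφ m) (hφ n) ht0 (δ := e * t / 8) (fun x => by
      have := (hN m hm n hn x (mem_univ _)).le
      rwa [dist_eq_norm] at this) x
    refine this.trans_lt ?_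
    have e1 : 2 * (e * t / 8) / t = e / 4 := by field_simp; ring
    have e2 : 2 * K * t ≤ e / 4 := by
      have : (K + 1) * t = e / 8 := by rw [ht]; field_simp
      nlinarith
    linarith
  have hpt : ∀ x, ∃ S, Filter.Tendsto (fun n => fderiv ℝ (φ n) x) Filter.atTop (nhds S) :=
    fun x => cauchySeq_tendsto_of_complete (hcau.cauchySeq (mem_univ x))
  choose S hS using hpt
  have hSu : TendstoUniformly (fun n => fderiv ℝ (φ n)) S Filter.atTop :=
    tendstoUniformlyOn_univ.1 (hcau.tendstoUniformlyOn_of_tendsto fun x _ => hS x)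
  have hder : ∀ x, HasFDerivAt ψ (S x) x :=
    hasFDerivAt_of_tendstoUniformly hSu (fun n x => ((hφ n).d x).hasFDerivAt)
      (fun x => hlim.tendsto_at x)
  have hfd : ∀ x, fderiv ℝ ψ x = S x := fun x => (hder x).fderiv
  refine ⟨fun x => (hder x).differentiableAt, fun x => ?_, fun x => ?_, fun x x' => ?_⟩
  · exact le_of_tendsto (hlim.tendsto_at x).norm (Filter.Eventually.of_forall fun n => (hφ n).b x)
  · rw [hfd]
    exact le_of_tendsto (hS x).norm (Filter.Eventually.of_forall fun n => (hφ n).l x)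
  · rw [hfd, hfd]
    exact le_of_tendsto ((hS x).sub (hS x')).norm
      (Filter.Eventually.of_forall fun n => (hφ n).k x x')

omit [NormedSpace ℝ X] [CompleteSpace X] in
lemma sup_lemma {u : X → ℝ} {B κ δ : ℝ} (hκ0 : 0 ≤ κ) (hκ : κ < 1) (hB : ∀ x, u x ≤ B)
    (h : ∀ x, ∃ x0, u x ≤ κ * u x0 + δ) (x : X) : u x ≤ δ / (1 - κ) := by
  have hb : BddAbove (range u) := ⟨B, by rintro _ ⟨x, rfl⟩; exact hB x⟩
  have h1 : (⨆ x, u x) ≤ κ * (⨆ x, u x) + δ := by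
    refine ciSup_le fun x => ?_
    obtain ⟨x0, h0⟩ := h x
    have := mul_le_mul_of_nonneg_left (le_ciSup hb x0) hκ0
    linarith
  refine (le_ciSup hb x).trans ?_
  rw [le_div_iff₀ (by linarith)]
  linarith

omit [CompleteSpace X] in
/-- one step of the attraction estimate -/
lemma attr_step {a : X × Y → X} {b : X × Y → Y} {r η A q M L K θ : ℝ}
    (hf : GoodF a b r η A q M) (hc : GoodC η A q M L K θ) {φ ψ : X → Y} (hφ : ∀ x, ‖φ x‖ ≤ r)
    (hψ : GoodG ψ r L K) (hinv : ∀ x, ψ (x + a (x, φ x)) = b (x, φ x))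
    (x : X) (y : Y) (hy : ‖y‖ ≤ r) :
    ‖b (x, y) - ψ (x + a (x, y))‖ ≤ (q + L * A) * ‖y - φ x‖ := by
  have h1 := lip_of_dir hf.db hf.b1 x x y (φ x) hy (hφ x)
  have h2 := lip_of_dir hf.da hf.a1 x x (φ x) y (hφ x) hy
  have h3 := hψ.lip (x + a (x, φ x)) (x + a (x, y))
  simp only [sub_self, norm_zero, mul_zero, zero_add, add_sub_add_left_eq_sub] at h1 h2 h3
  rw [norm_sub_rev (φ x) y] at h2
  have e : b (x, y) - ψ (x + a (x, y))
      = (b (x, y) - b (x, φ x)) + (ψ (x + a (x, φ x)) - ψ (x + a (x, y))) := by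
    rw [hinv]; abel
  rw [e]
  refine (norm_add_le _ _).trans ?_
  have := mul_le_mul_of_nonneg_left h2 hc.L0
  linarith

omit [CompleteSpace X] in
lemma compare {a a' : X × Y → X} {b b' : X × Y → Y} {r η A q M L K θ δ : ℝ}
    (hf : GoodF a b r η A q M) (hc : GoodC η A q M L K θ) {φ φ' : X → Y} (hφ : GoodG φ r L K)
    (hinv : ∀ x, φ (x + a (x, φ x)) = b (x, φ x)) (hφ' : ∀ x, ‖φ' x‖ ≤ r)
    (hinv' : ∀ x, φ' (x + a' (x, φ' x)) = b' (x, φ' x))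
    (hs : Function.Surjective fun x => x + a' (x, φ' x))
    (hda : ∀ x, ‖a (x, φ' x) - a' (x, φ' x)‖ ≤ δ) (hdb : ∀ x, ‖b' (x, φ' x) - b (x, φ' x)‖ ≤ δ)
    (x : X) : ‖φ' x - φ x‖ ≤ (1 + L) * δ / (1 - (q + L * A)) := by
  have hL := hc.L0
  have hA := hc.A0
  have hq := hc.q0
  refine sup_lemma (u := fun x => ‖φ' x - φ x‖) (B := r + r) (by positivity) hc.c3
    (fun x => (norm_sub_le _ _).trans (add_le_add (hφ' x) (hφ.b x))) (fun x' => ?_) x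
  obtain ⟨x, rfl⟩ := hs x'
  refine ⟨x, ?_⟩
  have h1 := attr_step hf hc hφ.b hφ hinv x (φ' x) (hφ' x)
  have h2 := hφ.lip (x + a (x, φ' x)) (x + a' (x, φ' x))
  rw [add_sub_add_left_eq_sub] at h2
  have h3 := mul_le_mul_of_nonneg_left (hda x) hL
  have e : φ' (x + a' (x, φ' x)) - φ (x + a' (x, φ' x)) =
      (b' (x, φ' x) - b (x, φ' x)) + (b (x, φ' x) - φ (x + a (x, φ' x)))
        + (φ (x + a (x, φ' x)) - φ (x + a' (x, φ' x))) := by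
    rw [hinv']; abel
  have h4 := norm_add₃_le (a := b' (x, φ' x) - b (x, φ' x)) (b := b (x, φ' x) - φ (x + a (x, φ' x)))
    (c := φ (x + a (x, φ' x)) - φ (x + a' (x, φ' x)))
  rw [← e] at h4
  have h5 := hdb x
  simp only
  linarith

lemma exists_fix [CompleteSpace Y] {a : X × Y → X} {b : X × Y → Y} {r η A q M L K θ : ℝ}
    (hr : 0 ≤ r) (hf : GoodF a b r η A q M) (hc : GoodC η A q M L K θ) :
    ∃ φ : X → Y, GoodG φ r L K ∧ (∀ x, φ (x + a (x, φ x)) = b (x, φ x)) ∧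
      Function.Surjective (fun x => x + a (x, φ x)) := by
  have hL := hc.L0
  have hA := hc.A0
  have hq := hc.q0
  have hK := hc.K0
  have step : ∀ φ : {φ : X → Y // GoodG φ r L K}, ∃ ψ : {φ : X → Y // GoodG φ r L K},
      ∀ x, ψ.1 (x + a (x, φ.1 x)) = b (x, φ.1 x) := by
    intro φ
    obtain ⟨-, ψ, h1, h2⟩ := graph_transform hf hc φ.2
    exact ⟨⟨ψ, h1⟩, h2⟩
  choose G hG using step
  have hz : GoodG (fun _ : X => (0 : Y)) r L K := by
    refine ⟨differentiable_const _, fun x => by simpa using hr, fun x => by simpa using hL,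
      fun x x' => ?_⟩
    simp only [fderiv_fun_const, Pi.zero_apply, sub_self, norm_zero]
    positivity
  set s : ℕ → {φ : X → Y // GoodG φ r L K} := fun n => G^[n] ⟨_, hz⟩ with hs
  have hsS : ∀ n, s (n + 1) = G (s n) := fun n => Function.iterate_succ_apply' _ _ _
  have hcontr : ∀ n x, ‖(s (n + 1)).1 x - (s n).1 x‖ ≤ 2 * r * (q + L * A) ^ n := by
    intro n
    induction n with
    | zero =>
      intro x
      have h1 := (s 1).2.b x
      have h2 := (s 0).2.b x
      have := norm_sub_le ((s 1).1 x) ((s 0).1 x)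
      simp only [zero_add, pow_zero]
      linarith
    | succ n ih =>
      intro x'
      obtain ⟨x, rfl⟩ := (graph_transform hf hc (s (n+1)).2).1 x'
      have h0 : ∀ x, (s (n+1)).1 (x + a (x, (s n).1 x)) = b (x, (s n).1 x) := by
        rw [hsS n]; exact hG (s n)
      have h0' : ∀ x, (s (n+1+1)).1 (x + a (x, (s (n+1)).1 x)) = b (x, (s (n+1)).1 x) := by
        rw [hsS (n+1)]; exact hG (s (n+1))
      have h1 := attr_step hf hc (s n).2.b (s (n+1)).2 h0 x ((s (n+1)).1 x) ((s (n+1)).2.b x)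
      simp only
      rw [h0']
      refine h1.trans ?_
      have := mul_le_mul_of_nonneg_left (ih x) (by positivity : 0 ≤ q + L * A)
      refine this.trans (le_of_eq ?_)
      ring
  have hd : ∀ x n, dist ((s n).1 x) ((s (n+1)).1 x) ≤ 2 * r * (q + L * A) ^ n := by
    intro x n
    rw [dist_comm, dist_eq_norm]; exact hcontr n x
  have hpt : ∀ x, ∃ y, Filter.Tendsto (fun n => (s n).1 x) Filter.atTop (nhds y) := fun x =>
    cauchySeq_tendsto_of_complete (cauchySeq_of_le_geometric _ _ hc.c3 (hd x))
  choose φ hφ using hpt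
  have hunif : TendstoUniformly (fun n => (s n).1) φ Filter.atTop := by
    rw [Metric.tendstoUniformly_iff]
    intro e he
    have hlim : Filter.Tendsto (fun n : ℕ => 2 * r * (q + L * A) ^ n / (1 - (q + L * A)))
        Filter.atTop (nhds 0) := by
      have := ((tendsto_pow_atTop_nhds_zero_of_lt_one (by positivity) hc.c3).const_mul
        (2 * r)).div_const (1 - (q + L * A))
      simpa using this
    filter_upwards [hlim.eventually (gt_mem_nhds he)] with n hn x
    rw [dist_comm]
    exact (dist_le_of_le_geometric_of_tendsto _ _ hc.c3 (hd x) (hφ x) n).trans_lt hn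
  have hgood : GoodG φ r L K := goodG_limit hK (fun n => (s n).2) hunif
  refine ⟨φ, hgood, fun x => ?_, (graph_transform hf hc hgood).1⟩
  have h1 : Filter.Tendsto (fun n => x + a (x, (s n).1 x)) Filter.atTop
      (nhds (x + a (x, φ x))) :=
    tendsto_const_nhds.add ((hf.da.continuous.tendsto _).comp
      (tendsto_const_nhds.prodMk_nhds (hφ x)))
  have h2 : Filter.Tendsto (fun n => b (x, (s n).1 x)) Filter.atTop (nhds (b (x, φ x))) :=
    (hf.db.continuous.tendsto _).comp (tendsto_const_nhds.prodMk_nhds (hφ x))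
  have h3 : Filter.Tendsto (fun n => (s (n+1)).1 (x + a (x, (s n).1 x))) Filter.atTop
      (nhds (φ (x + a (x, φ x)))) := by
    have hu2 : TendstoUniformly (fun n => (s (n+1)).1) φ Filter.atTop := by
      intro v hv
      exact (Filter.tendsto_add_atTop_nat 1).eventually (hunif v hv)
    exact hu2.tendsto_comp hgood.d.continuous.continuousAt h1
  refine tendsto_nhds_unique h3 (h2.congr fun n => ?_)
  rw [hsS, hG]

end Abstract

section Slice

variable {X Y Z : Type*} [NormedAddCommGroup X] [NormedSpace ℝ X]
  [NormedAddCommGroup Y] [NormedSpace ℝ Y] [NormedAddCommGroup Z] [NormedSpace ℝ Z]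

structure Bdd (F : ℝ × ℝ × X × Y → Z) (C M : ℝ) : Prop where
  M0 : 0 ≤ M
  d : Differentiable ℝ F
  d2 : Differentiable ℝ (fderiv ℝ F)
  b0 : ∀ ω ε x y, |ω| ≤ C → |ε| ≤ C → ‖y‖ ≤ C → ‖F (ω, ε, x, y)‖ ≤ M
  b1 : ∀ ω ε x y, |ω| ≤ C → |ε| ≤ C → ‖y‖ ≤ C → ‖fderiv ℝ F (ω, ε, x, y)‖ ≤ M
  b2 : ∀ ω ε x y, |ω| ≤ C → |ε| ≤ C → ‖y‖ ≤ C → ‖fderiv ℝ (fderiv ℝ F) (ω, ε, x, y)‖ ≤ M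

lemma convex_region (C : ℝ) :
    Convex ℝ {p : ℝ × ℝ × X × Y | |p.1| ≤ C ∧ |p.2.1| ≤ C ∧ ‖p.2.2.2‖ ≤ C} := by
  have e : {p : ℝ × ℝ × X × Y | |p.1| ≤ C ∧ |p.2.1| ≤ C ∧ ‖p.2.2.2‖ ≤ C}
      = (Metric.closedBall (0 : ℝ) C) ×ˢ ((Metric.closedBall (0 : ℝ) C) ×ˢ
        ((univ : Set X) ×ˢ (Metric.closedBall (0 : Y) C))) := by
    ext p; simp
  rw [e]
  exact (convex_closedBall _ _).prod ((convex_closedBall _ _).prod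
    (convex_univ.prod (convex_closedBall _ _)))

lemma Bdd.lip {F : ℝ × ℝ × X × Y → Z} {C M : ℝ} (h : Bdd F C M) (ω ε ω' ε' : ℝ) (x x' : X)
    (y y' : Y) (h1 : |ω| ≤ C) (h2 : |ε| ≤ C) (h3 : ‖y‖ ≤ C)
    (h1' : |ω'| ≤ C) (h2' : |ε'| ≤ C) (h3' : ‖y'‖ ≤ C) :
    ‖F (ω, ε, x, y) - F (ω', ε', x', y')‖
      ≤ M * ‖((ω, ε, x, y) - (ω', ε', x', y') : ℝ × ℝ × X × Y)‖ :=
  (convex_region (X := X) (Y := Y) C).norm_image_sub_le_of_norm_fderiv_le (fun p _ => h.d p)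
    (fun p hp => h.b1 p.1 p.2.1 p.2.2.1 p.2.2.2 hp.1 hp.2.1 hp.2.2) ⟨h1', h2', h3'⟩ ⟨h1, h2, h3⟩

lemma Bdd.lip2 {F : ℝ × ℝ × X × Y → Z} {C M : ℝ} (h : Bdd F C M) (ω ε ω' ε' : ℝ) (x x' : X)
    (y y' : Y) (h1 : |ω| ≤ C) (h2 : |ε| ≤ C) (h3 : ‖y‖ ≤ C)
    (h1' : |ω'| ≤ C) (h2' : |ε'| ≤ C) (h3' : ‖y'‖ ≤ C) :
    ‖fderiv ℝ F (ω, ε, x, y) - fderiv ℝ F (ω', ε', x', y')‖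
      ≤ M * ‖((ω, ε, x, y) - (ω', ε', x', y') : ℝ × ℝ × X × Y)‖ :=
  (convex_region (X := X) (Y := Y) C).norm_image_sub_le_of_norm_fderiv_le (fun p _ => h.d2 p)
    (fun p hp => h.b2 p.1 p.2.1 p.2.2.1 p.2.2.2 hp.1 hp.2.1 hp.2.2) ⟨h1', h2', h3'⟩ ⟨h1, h2, h3⟩

lemma bdd_of {F : ℝ × ℝ × X × Y → Z} {C M : ℝ} (hC : 0 ≤ C) (hF : ContDiff ℝ 2 F)
    (h : ∀ ω ε x y, |ω| ≤ C → |ε| ≤ C → ‖y‖ ≤ C → ∀ i : ℕ, i ≤ 2 →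
      ‖iteratedFDeriv ℝ i F (ω, ε, x, y)‖ ≤ M) : Bdd F C M := by
  refine ⟨?_, hF.differentiable (by norm_num), ?_, ?_, ?_, ?_⟩
  · exact (norm_nonneg _).trans (h 0 0 0 0 (by simpa) (by simpa) (by simpa) 0 (by norm_num))
  · exact (hF.fderiv_right (m := 1) (by norm_num)).differentiable (by norm_num)
  · intro ω ε x y h1 h2 h3
    simpa using h ω ε x y h1 h2 h3 0 (by norm_num)
  · intro ω ε x y h1 h2 h3
    simpa [norm_iteratedFDeriv_one] using h ω ε x y h1 h2 h3 1 (by norm_num)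
  · intro ω ε x y h1 h2 h3
    have := h ω ε x y h1 h2 h3 2 (by norm_num)
    rwa [← norm_iteratedFDeriv_fderiv, norm_iteratedFDeriv_one] at this

lemma slice_deriv {F : ℝ × ℝ × X × Y → Z} (hF : Differentiable ℝ F) (ω ε : ℝ) (z : X × Y) :
    HasFDerivAt (fun z : X × Y => F (ω, ε, z)) ((fderiv ℝ F (ω, ε, z)).comp
      ((ContinuousLinearMap.inr ℝ ℝ (ℝ × X × Y)).comp (ContinuousLinearMap.inr ℝ ℝ (X × Y)))) z :=
  (hF (ω, ε, z)).hasFDerivAt.comp z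
    ((hasFDerivAt_prodMk_right ω (ε, z)).comp z (hasFDerivAt_prodMk_right ε z))

lemma slice_lip {F : ℝ × ℝ × X × Y → Z} {C M : ℝ} (h : Bdd F C M) (ω ε : ℝ) (x x' : X)
    (y y' : Y) (h1 : |ω| ≤ C) (h2 : |ε| ≤ C) (h3 : ‖y‖ ≤ C) (h3' : ‖y'‖ ≤ C) :
    ‖fderiv ℝ (fun z : X × Y => F (ω, ε, z)) (x, y)
      - fderiv ℝ (fun z : X × Y => F (ω, ε, z)) (x', y')‖ ≤ M * (‖x - x'‖ + ‖y - y'‖) := by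
  have hM := h.M0
  rw [(slice_deriv h.d ω ε (x, y)).fderiv, (slice_deriv h.d ω ε (x', y')).fderiv]
  refine ContinuousLinearMap.opNorm_le_bound _ (by positivity) fun w => ?_
  have h4 := h.lip2 ω ε ω ε x x' y y' h1 h2 h3 h1 h2 h3'
  have e1 : ‖((ω, ε, x, y) - (ω, ε, x', y') : ℝ × ℝ × X × Y)‖ ≤ ‖x - x'‖ + ‖y - y'‖ := by
    simp [Prod.norm_def]
  have h5 : ‖fderiv ℝ F (ω, ε, x, y) - fderiv ℝ F (ω, ε, x', y')‖ ≤ M * (‖x - x'‖ + ‖y - y'‖) :=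
    h4.trans (by gcongr)
  have := ContinuousLinearMap.le_of_opNorm_le _ h5 ((0, 0, w) : ℝ × ℝ × X × Y)
  have e2 : ‖((0, 0, w) : ℝ × ℝ × X × Y)‖ = ‖w‖ := by simp [Prod.norm_def]
  rw [e2] at this
  exact this

lemma zero_deriv {F : ℝ × ℝ × X × Y → Z} (hF : Differentiable ℝ F)
    (hi : ∀ ω ω' x x' y, F (ω, 0, x, y) = F (ω', 0, x', y)) (ω : ℝ) (x u : X) (y : Y) :
    fderiv ℝ F (ω, 0, x, y) (0, 0, u, 0) = 0 := by
  have h1 : HasDerivAt (fun t : ℝ => ((ω, 0, x, y) : ℝ × ℝ × X × Y) + t • (0, 0, u, 0))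
      (0, 0, u, 0) 0 := by
    simpa using ((hasDerivAt_id (0 : ℝ)).smul_const ((0, 0, u, 0) : ℝ × ℝ × X × Y)).const_add
      (ω, 0, x, y)
  have h2 : HasDerivAt (fun t : ℝ => F (((ω, 0, x, y) : ℝ × ℝ × X × Y) + t • (0, 0, u, 0)))
      (fderiv ℝ F (ω, 0, x, y) (0, 0, u, 0)) 0 := by
    have h3 : HasFDerivAt F (fderiv ℝ F (ω, 0, x, y))
      (((ω, 0, x, y) : ℝ × ℝ × X × Y) + (0 : ℝ) • (0, 0, u, 0)) := by
      simpa using (hF (ω, 0, x, y)).hasFDerivAt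
    exact h3.comp_hasDerivAt 0 h1
  have h4 : (fun t : ℝ => F (((ω, 0, x, y) : ℝ × ℝ × X × Y) + t • (0, 0, u, 0)))
      = fun _ => F (ω, 0, x, y) := by
    funext t
    simpa using hi ω ω (x + t • u) x y
  rw [h4] at h2
  exact h2.unique (hasDerivAt_const _ _)

lemma slice_bound {F : ℝ × ℝ × X × Y → Z} {C M Q : ℝ} (h : Bdd F C M)
    (hi : ∀ ω ω' x x' y, F (ω, 0, x, y) = F (ω', 0, x', y)) (ω ε : ℝ) (x : X) (y : Y)
    (h1 : |ω| ≤ C) (h2 : |ε| ≤ C) (h3 : ‖y‖ ≤ C)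
    (hQ : ∀ v, ‖fderiv ℝ F (ω, ε, x, y) (0, 0, 0, v)‖ ≤ Q * ‖v‖) (u : X) (v : Y) :
    ‖fderiv ℝ (fun z : X × Y => F (ω, ε, z)) (x, y) (u, v)‖ ≤ M * |ε| * ‖u‖ + Q * ‖v‖ := by
  rw [(slice_deriv h.d ω ε (x, y)).fderiv]
  have hC : |(0 : ℝ)| ≤ C := by simpa using (abs_nonneg ω).trans h1
  have h4 := h.lip2 ω ε ω 0 x x y y h1 h2 h3 h1 hC h3
  have e1 : ‖((ω, ε, x, y) - (ω, 0, x, y) : ℝ × ℝ × X × Y)‖ = |ε| := by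
    simp [Prod.norm_def]
  rw [e1] at h4
  have h5 := ContinuousLinearMap.le_of_opNorm_le _ h4 ((0, 0, u, 0) : ℝ × ℝ × X × Y)
  have e2 : ‖((0, 0, u, 0) : ℝ × ℝ × X × Y)‖ = ‖u‖ := by simp [Prod.norm_def]
  rw [e2, sub_apply, zero_deriv h.d hi, sub_zero] at h5
  have e3 : ((0, 0, u, v) : ℝ × ℝ × X × Y) = (0, 0, u, 0) + (0, 0, 0, v) := by simp
  change ‖fderiv ℝ F (ω, ε, x, y) (0, 0, u, v)‖ ≤ _
  rw [e3, map_add]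
  exact (norm_add_le _ _).trans (add_le_add h5 (hQ v))

lemma y_bound {F : ℝ × ℝ × X × Y → Z} {C M : ℝ} (h : Bdd F C M) (ω ε : ℝ) (x : X) (y v : Y)
    (h1 : |ω| ≤ C) (h2 : |ε| ≤ C) (h3 : ‖y‖ ≤ C) :
    ‖fderiv ℝ F (ω, ε, x, y) (0, 0, 0, v)‖ ≤ M * ‖v‖ := by
  have h5 := ContinuousLinearMap.le_of_opNorm_le _ (h.b1 ω ε x y h1 h2 h3)
    ((0, 0, 0, v) : ℝ × ℝ × X × Y)
  have e2 : ‖((0, 0, 0, v) : ℝ × ℝ × X × Y)‖ = ‖v‖ := by simp [Prod.norm_def]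
  rwa [e2] at h5

lemma y_bound' {F : ℝ × ℝ × X × Y → Z} {C M q r₁ : ℝ} (h : Bdd F C M) (hq : 0 ≤ q)
    (hi : ∀ ω ω' x x' y, F (ω, 0, x, y) = F (ω', 0, x', y))
    (hcon : ∀ y₁ y₂ : Y, ‖y₁‖ ≤ r₁ → ‖y₂‖ ≤ r₁ →
      ‖F (0, 0, 0, y₁) - F (0, 0, 0, y₂)‖ ≤ q * ‖y₁ - y₂‖)
    (ω ε : ℝ) (x : X) (y v : Y)
    (h1 : |ω| ≤ C) (h2 : |ε| ≤ C) (h3 : ‖y‖ ≤ C) (h4 : ‖y‖ < r₁) :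
    ‖fderiv ℝ F (ω, ε, x, y) (0, 0, 0, v)‖ ≤ (q + M * |ε|) * ‖v‖ := by
  have hC : |(0 : ℝ)| ≤ C := by simpa using (abs_nonneg ω).trans h1
  have h5 := h.lip2 ω ε ω 0 x x y y h1 h2 h3 h1 hC h3
  have e1 : ‖((ω, ε, x, y) - (ω, 0, x, y) : ℝ × ℝ × X × Y)‖ = |ε| := by
    simp [Prod.norm_def]
  rw [e1] at h5
  have h6 := ContinuousLinearMap.le_of_opNorm_le _ h5 ((0, 0, 0, v) : ℝ × ℝ × X × Y)
  have e2 : ‖((0, 0, 0, v) : ℝ × ℝ × X × Y)‖ = ‖v‖ := by simp [Prod.norm_def]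
  rw [e2, sub_apply] at h6
  have h7 := (slice_deriv h.d ω 0 (x, y)).comp y (hasFDerivAt_prodMk_right x y)
  have h8 := h7.le_of_lip' (C := q) hq (by
    have : ∀ᶠ y' in nhds y, ‖y'‖ < r₁ := continuous_norm.continuousAt.eventually (gt_mem_nhds h4)
    filter_upwards [this] with y' hy'
    have := hcon y' y hy'.le h4.le
    rw [hi 0 ω 0 x y', hi 0 ω 0 x y] at this
    exact this)
  have h9 : ‖fderiv ℝ F (ω, 0, x, y) (0, 0, 0, v)‖ ≤ q * ‖v‖ :=
    ContinuousLinearMap.le_of_opNorm_le _ h8 v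
  have h10 := norm_add_le (fderiv ℝ F (ω, ε, x, y) (0, 0, 0, v)
    - fderiv ℝ F (ω, 0, x, y) (0, 0, 0, v)) (fderiv ℝ F (ω, 0, x, y) (0, 0, 0, v))
  rw [sub_add_cancel] at h10
  linarith

lemma smul_norm_le_one {V : Type*} [NormedAddCommGroup V] [NormedSpace ℝ V] {ω : ℝ}
    (hω1 : |ω| ≤ 1) (w : V) : ‖ω • w‖ ≤ ‖w‖ := by
  rw [norm_smul, Real.norm_eq_abs]
  exact mul_le_of_le_one_left (norm_nonneg _) hω1

lemma goodF_of {Fα : ℝ × ℝ × X × Y → X} {Fβ : ℝ × ℝ × X × Y → Y} {r₀ r₁ C M q e Q : ℝ}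
    (hα : Bdd Fα C M) (hβ : Bdd Fβ C M)
    (hiα : ∀ ω ω' x x' y, Fα (ω, 0, x, y) = Fα (ω', 0, x', y))
    (hiβ : ∀ ω ω' x x' y, Fβ (ω, 0, x, y) = Fβ (ω', 0, x', y))
    (h0 : Fβ (0, 0, 0, 0) = 0) (hq : 0 ≤ q)
    (hcon : ∀ y₁ y₂ : Y, ‖y₁‖ ≤ r₁ → ‖y₂‖ ≤ r₁ →
      ‖Fβ (0, 0, 0, y₁) - Fβ (0, 0, 0, y₂)‖ ≤ q * ‖y₁ - y₂‖)
    (hr0 : 0 < r₀) (hr : r₀ < r₁) (hrC : r₁ ≤ C) (hC : 1 ≤ C) (he : e ≤ C)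
    (hQ : q + M * e ≤ Q) (hr' : q * r₀ + M * e ≤ r₀)
    {ω ε : ℝ} (hω : ω ∈ Icc (0 : ℝ) 1) (hε : |ε| ≤ e) :
    GoodF (fun z : X × Y => ω • Fα (ω, ε, z)) (fun z : X × Y => Fβ (ω, ε, z)) r₀ (M * e) M Q M := by
  have hM := hα.M0
  have hω1 : |ω| ≤ 1 := by rw [abs_of_nonneg hω.1]; exact hω.2
  have hωC : |ω| ≤ C := hω1.trans hC
  have hεC : |ε| ≤ C := hε.trans he
  have hyC : ∀ y : Y, ‖y‖ ≤ r₀ → ‖y‖ ≤ C := fun y hy => by linarith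
  have dα : Differentiable ℝ (fun z : X × Y => Fα (ω, ε, z)) := fun z =>
    (slice_deriv hα.d ω ε z).differentiableAt
  have hfd : ∀ z, fderiv ℝ (fun z : X × Y => ω • Fα (ω, ε, z)) z
      = ω • fderiv ℝ (fun z : X × Y => Fα (ω, ε, z)) z := fun z => fderiv_fun_const_smul (dα z) ω
  refine ⟨dα.const_smul ω, fun z => (slice_deriv hβ.d ω ε z).differentiableAt, ?_, ?_, ?_, ?_, ?_⟩
  · intro x y hy u v
    rw [hfd]
    refine (smul_norm_le_one hω1 _).trans ((slice_bound hα hiα ω ε x y hωC hεC (hyC y hy)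
      (fun v => y_bound hα ω ε x y v hωC hεC (hyC y hy)) u v).trans ?_)
    gcongr
  · intro x y hy u v
    refine ((slice_bound hβ hiβ ω ε x y hωC hεC (hyC y hy)
      (fun v => y_bound' hβ hq hiβ hcon ω ε x y v hωC hεC (hyC y hy) (by linarith)) u v).trans ?_)
    have : q + M * |ε| ≤ Q := le_trans (by gcongr) hQ
    gcongr
  · intro x y x' y' hy hy'
    rw [hfd, hfd]
    have e1 : ω • fderiv ℝ (fun z : X × Y => Fα (ω, ε, z)) (x, y)
        - ω • fderiv ℝ (fun z : X × Y => Fα (ω, ε, z)) (x', y')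
        = ω • (fderiv ℝ (fun z : X × Y => Fα (ω, ε, z)) (x, y)
        - fderiv ℝ (fun z : X × Y => Fα (ω, ε, z)) (x', y')) := by
      ext <;> simp [smul_sub]
    rw [e1]
    exact (smul_norm_le_one hω1 _).trans (slice_lip hα ω ε x x' y y' hωC hεC (hyC y hy) (hyC y' hy'))
  · intro x y x' y' hy hy'
    exact slice_lip hβ ω ε x x' y y' hωC hεC (hyC y hy) (hyC y' hy')
  · intro x y hy
    have hC0 : |(0 : ℝ)| ≤ C := by simpa using (abs_nonneg ω).trans hωC
    have h5 := hβ.lip ω ε ω 0 x x y y hωC hεC (hyC y hy) hωC hC0 (hyC y hy)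
    have e1 : ‖((ω, ε, x, y) - (ω, 0, x, y) : ℝ × ℝ × X × Y)‖ = |ε| := by
      simp [Prod.norm_def]
    rw [e1] at h5
    have h6 := hcon y 0 (by linarith) (by simp; linarith)
    rw [h0, sub_zero, sub_zero, hiβ 0 ω 0 x y] at h6
    have h7 := norm_add_le (Fβ (ω, ε, x, y) - Fβ (ω, 0, x, y)) (Fβ (ω, 0, x, y))
    rw [sub_add_cancel] at h7
    have h8 : M * |ε| ≤ M * e := by gcongr
    have h9 : q * ‖y‖ ≤ q * r₀ := by gcongr
    change ‖Fβ (ω, ε, x, y)‖ ≤ r₀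
    linarith

end Slice

lemma exists_consts {M q r₁ : ℝ} (hM : 0 ≤ M) (hq0 : 0 ≤ q) (hq1 : q < 1) (hr₁ : 0 < r₁) :
    ∃ e L K θ : ℝ, 0 < e ∧ e ≤ 1 ∧ q + M * e ≤ (1 + q) / 2 ∧
      q * (r₁ / 2) + M * e ≤ r₁ / 2 ∧ GoodC (M * e) M ((1 + q) / 2) M L K θ := by
  set g := (1 - q) / 2 with hg
  have hg0 : 0 < g := by rw [hg]; linarith
  have hg1 : g ≤ 1 / 2 := by rw [hg]; linarith
  have eq : (1 + q) / 2 = 1 - g := by rw [hg]; ring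
  set L := g / (8 * (M + 1)) with hL
  have hL0 : 0 < L := by positivity
  have hLM : (M + 1) * L = g / 8 := by rw [hL]; field_simp
  set e := min 1 (min (g * L / (8 * (M + 1))) (g * r₁ / (M + 1))) with he
  have he0 : 0 < e := by positivity
  have h1 : (M + 1) * e ≤ g * L / 8 := by
    have : e ≤ g * L / (8 * (M + 1)) := (min_le_right _ _).trans (min_le_left _ _)
    calc (M + 1) * e ≤ (M + 1) * (g * L / (8 * (M + 1))) := by gcongr
      _ = g * L / 8 := by field_simp
  have h2 : (M + 1) * e ≤ g * r₁ := by
    have : e ≤ g * r₁ / (M + 1) := (min_le_right _ _).trans (min_le_right _ _)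
    calc (M + 1) * e ≤ (M + 1) * (g * r₁ / (M + 1)) := by gcongr
      _ = g * r₁ := by field_simp
  have hML : M * L ≤ g / 8 := by nlinarith
  have hMe : M * e ≤ g * L / 8 := by nlinarith
  have hLs : L ≤ 1 := by nlinarith
  have hMeg : M * e ≤ g / 8 := by nlinarith
  refine ⟨e, L, M * (1 + L) ^ 3 * (8 / (3 * g)), g / 4, he0, min_le_left _ _, ?_, ?_, ?_⟩
  · rw [eq]; have : q = 1 - 2 * g := by rw [hg]; ring
    linarith
  · have : q = 1 - 2 * g := by rw [hg]; ring
    rw [this]; nlinarith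
  · rw [eq]
    set K := M * (1 + L) ^ 3 * (8 / (3 * g)) with hK
    have hK0 : 0 ≤ K := by positivity
    have hKg : M * (1 + L) ^ 3 = K * (3 * g / 8) := by rw [hK]; field_simp
    refine ⟨by positivity, hM, by linarith, hM, hL0.le, hK0, by linarith, ?_, ?_, ?_, ?_⟩
    · linarith
    · nlinarith
    · nlinarith
    · rw [hKg]
      have : 3 * g / 8 + (1 - g + L * M) ≤ (1 - g / 4) ^ 2 := by nlinarith
      have := mul_le_mul_of_nonneg_left this hK0
      linarith
/-- Theorem 2.1: existence, uniqueness, attractivity, boundedness and continuous dependence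
of the invariant manifold `φ_{ω,ε}`. -/
theorem stmt0 (k₁ k₂ : ℕ) (r₁ : ℝ) (hr₁ : 0 < r₁)
    (α : ℝ → ℝ → Euc k₁ → Euc k₂ → Euc k₁)
    (β : ℝ → ℝ → Euc k₁ → Euc k₂ → Euc k₂)
    (hαC2 : ContDiff ℝ 2 (fun p : ℝ × ℝ × Euc k₁ × Euc k₂ => α p.1 p.2.1 p.2.2.1 p.2.2.2))
    (hβC2 : ContDiff ℝ 2 (fun p : ℝ × ℝ × Euc k₁ × Euc k₂ => β p.1 p.2.1 p.2.2.1 p.2.2.2))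
    (hA1 : ∀ C : ℝ, ∃ M : ℝ, ∀ (ω ε : ℝ) (x : Euc k₁) (y : Euc k₂),
      |ω| ≤ C → |ε| ≤ C → ‖y‖ ≤ C → ∀ i : ℕ, i ≤ 2 →
        ‖iteratedFDeriv ℝ i (fun p : ℝ × ℝ × Euc k₁ × Euc k₂ => α p.1 p.2.1 p.2.2.1 p.2.2.2)
            (ω, ε, x, y)‖ ≤ M ∧
        ‖iteratedFDeriv ℝ i (fun p : ℝ × ℝ × Euc k₁ × Euc k₂ => β p.1 p.2.1 p.2.2.1 p.2.2.2)
            (ω, ε, x, y)‖ ≤ M)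
    (hA2α : ∀ (ω ω' : ℝ) (x x' : Euc k₁) (y : Euc k₂), α ω 0 x y = α ω' 0 x' y)
    (hA2β : ∀ (ω ω' : ℝ) (x x' : Euc k₁) (y : Euc k₂), β ω 0 x y = β ω' 0 x' y)
    (hA20 : β 0 0 0 0 = 0)
    (hA3inv : ∃ Beq : Euc k₂ ≃L[ℝ] Euc k₂,
      (Beq : Euc k₂ →L[ℝ] Euc k₂) = fderiv ℝ (fun y : Euc k₂ => β 0 0 0 y) 0)
    (q : ℝ) (hq0 : 0 ≤ q) (hq1 : q < 1)
    (hA3q : ∀ y₁ y₂ : Euc k₂, ‖y₁‖ ≤ r₁ → ‖y₂‖ ≤ r₁ →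
      ‖β 0 0 0 y₁ - β 0 0 0 y₂‖ ≤ q * ‖y₁ - y₂‖) :
    ∃ ε₀ : ℝ, 0 < ε₀ ∧ ∃ r₀ : ℝ, 0 < r₀ ∧ r₀ < r₁ ∧
      ∃ Φ : ℝ → ℝ → Euc k₁ → Euc k₂,
        (∀ ω ∈ Icc (0:ℝ) 1, ∀ ε ∈ Ioo (-ε₀) ε₀,
          (ContDiff ℝ 1 (Φ ω ε) ∧ (∀ x : Euc k₁, ‖Φ ω ε x‖ ≤ r₀) ∧
            fInv (fmap α β ω ε) (Φ ω ε) ∧ fAttr (fmap α β ω ε) r₀ r₁ (Φ ω ε)) ∧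
          (∀ φ' : Euc k₁ → Euc k₂, ContDiff ℝ 1 φ' → (∀ x : Euc k₁, ‖φ' x‖ ≤ r₀) →
            fInv (fmap α β ω ε) φ' → fAttr (fmap α β ω ε) r₀ r₁ φ' → φ' = Φ ω ε)) ∧
        ContinuousOn (fun p : (ℝ × ℝ) × Euc k₁ => Φ p.1.1 p.1.2 p.2)
          ((Icc (0:ℝ) 1 ×ˢ Ioo (-ε₀) ε₀) ×ˢ (univ : Set (Euc k₁))) ∧
        (∀ ω ∈ Icc (0:ℝ) 1, ∀ x : Euc k₁, Φ ω 0 x = 0) := by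
  -- setup
  obtain ⟨M, hM⟩ := hA1 (1 + r₁)
  have hα : Bdd (fun p : ℝ × ℝ × Euc k₁ × Euc k₂ => α p.1 p.2.1 p.2.2.1 p.2.2.2) (1 + r₁) M :=
    bdd_of (by linarith) hαC2 fun ω ε x y h1 h2 h3 i hi => (hM ω ε x y h1 h2 h3 i hi).1
  have hβ : Bdd (fun p : ℝ × ℝ × Euc k₁ × Euc k₂ => β p.1 p.2.1 p.2.2.1 p.2.2.2) (1 + r₁) M :=
    bdd_of (by linarith) hβC2 fun ω ε x y h1 h2 h3 i hi => (hM ω ε x y h1 h2 h3 i hi).2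
  have hM0 := hα.M0
  obtain ⟨e, L, K, θ, he0, he1, hQ, hr', hc⟩ := exists_consts hM0 hq0 hq1 hr₁
  set Q := (1 + q) / 2 with hQdef
  set r₀ := r₁ / 2 with hr₀def
  have hr0 : 0 < r₀ := by rw [hr₀def]; linarith
  have hr01 : r₀ < r₁ := by rw [hr₀def]; linarith
  have habs : ∀ ε ∈ Ioo (-e) e, |ε| ≤ e := fun ε hε => abs_le.2 ⟨hε.1.le, hε.2.le⟩
  have hgood : ∀ ω ∈ Icc (0 : ℝ) 1, ∀ ε ∈ Ioo (-e) e,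
      GoodF (fun z : Euc k₁ × Euc k₂ => ω • α ω ε z.1 z.2)
        (fun z : Euc k₁ × Euc k₂ => β ω ε z.1 z.2) r₀ (M * e) M Q M := fun ω hω ε hε =>
    goodF_of hα hβ hA2α hA2β hA20 hq0 hA3q hr0 hr01 (by linarith) (by linarith) (by linarith)
      hQ hr' hω (habs ε hε)
  have hex : ∀ ω ε : ℝ, ∃ φ : Euc k₁ → Euc k₂, ω ∈ Icc (0 : ℝ) 1 → ε ∈ Ioo (-e) e →
      GoodG φ r₀ L K ∧ (∀ x, φ (x + ω • α ω ε x (φ x)) = β ω ε x (φ x)) ∧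
      Function.Surjective (fun x => x + ω • α ω ε x (φ x)) := by
    intro ω ε
    by_cases h : ω ∈ Icc (0 : ℝ) 1 ∧ ε ∈ Ioo (-e) e
    · obtain ⟨φ, h1⟩ := exists_fix hr0.le (hgood ω h.1 ε h.2) hc
      exact ⟨φ, fun _ _ => h1⟩
    · exact ⟨0, fun h1 h2 => (h ⟨h1, h2⟩).elim⟩
  choose Φ hΦ using hex
  have hκ : 0 ≤ Q + L * M := add_nonneg hc.q0 (mul_nonneg hc.L0 hM0)
  -- uniqueness among invariant graphs
  have huniq : ∀ ω ∈ Icc (0 : ℝ) 1, ∀ ε ∈ Ioo (-e) e, ∀ φ' : Euc k₁ → Euc k₂,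
      (∀ x, ‖φ' x‖ ≤ r₀) → fInv (fmap α β ω ε) φ' → φ' = Φ ω ε := by
    intro ω hω ε hε φ' hb hinv
    obtain ⟨h1, h2, h3⟩ := hΦ ω ε hω hε
    have i1 : ∀ x, φ' (x + ω • α ω ε x (φ' x)) = β ω ε x (φ' x) := by
      intro x
      have : fmap α β ω ε (x, φ' x) ∈ {p : Euc k₁ × Euc k₂ | p.2 = φ' p.1} := by
        rw [← hinv]; exact ⟨(x, φ' x), rfl, rfl⟩
      exact this.symm
    have i2 : Function.Surjective (fun x => x + ω • α ω ε x (φ' x)) := by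
      intro x'
      have : ((x', φ' x') : Euc k₁ × Euc k₂) ∈ fmap α β ω ε ''
          {p : Euc k₁ × Euc k₂ | p.2 = φ' p.1} := by
        rw [hinv]; rfl
      obtain ⟨⟨x, y⟩, hy, hxy⟩ := this
      have hy' : y = φ' x := hy
      subst hy'
      exact ⟨x, congrArg Prod.fst hxy⟩
    funext x
    have := compare (δ := 0) (hgood ω hω ε hε) hc h1 h2 hb
      (a' := fun z : Euc k₁ × Euc k₂ => ω • α ω ε z.1 z.2)
      (b' := fun z : Euc k₁ × Euc k₂ => β ω ε z.1 z.2) i1 i2 (by simp) (by simp) x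
    rw [mul_zero, zero_div] at this
    exact sub_eq_zero.1 (norm_le_zero_iff.1 this)
  refine ⟨e, he0, r₀, hr0, hr01, Φ, ?_, ?_, ?_⟩
  · intro ω hω ε hε
    obtain ⟨h1, h2, h3⟩ := hΦ ω ε hω hε
    refine ⟨⟨?_, h1.b, ?_, ?_⟩, fun φ' _ hb hinv _ => huniq ω hω ε hε φ' hb hinv⟩
    · rw [contDiff_one_iff_fderiv]
      refine ⟨h1.d, ?_⟩
      exact (LipschitzWith.of_dist_le_mul (K := ⟨K, hc.K0⟩) fun x x' => by
        rw [dist_eq_norm, dist_eq_norm]; exact h1.k x x').continuous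
    · ext ⟨x', y'⟩
      constructor
      · rintro ⟨⟨x, y⟩, hy, hxy⟩
        have hy' : y = Φ ω ε x := hy
        subst hy'
        rw [← hxy]
        exact (h2 x).symm
      · intro hy
        have hy' : y' = Φ ω ε x' := hy
        subst hy'
        obtain ⟨x, rfl⟩ := h3 x'
        exact ⟨(x, Φ ω ε x), rfl, Prod.ext rfl (h2 x).symm⟩
    · have key : ∀ z₀ : Euc k₁ × Euc k₂, ‖z₀.2‖ ≤ r₀ → ∀ j : ℕ,
          ‖((fmap α β ω ε)^[j] z₀).2‖ ≤ r₀ ∧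
          ‖((fmap α β ω ε)^[j] z₀).2 - Φ ω ε ((fmap α β ω ε)^[j] z₀).1‖
            ≤ (Q + L * M) ^ j * (2 * r₀) := by
        intro z₀ hz j
        induction j with
        | zero =>
          refine ⟨hz, ?_⟩
          have := norm_sub_le z₀.2 (Φ ω ε z₀.1)
          have := h1.b z₀.1
          simp only [Function.iterate_zero, id, pow_zero]
          linarith
        | succ j ih =>
          rw [Function.iterate_succ_apply']
          set z := (fmap α β ω ε)^[j] z₀ with hzdef
          refine ⟨(hgood ω hω ε hε).b0 z.1 z.2 ih.1, ?_⟩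
          have s := attr_step (hgood ω hω ε hε) hc h1.b h1 h2 z.1 z.2 ih.1
          refine (le_trans s (mul_le_mul_of_nonneg_left ih.2 hκ)).trans (le_of_eq ?_)
          ring
      refine ⟨fun z₀ hz j => (key z₀ hz j).1.trans hr01.le, fun δ hδ => ?_⟩
      have hlim : Filter.Tendsto (fun n : ℕ => (Q + L * M) ^ n * (2 * r₀))
          Filter.atTop (nhds 0) := by
        simpa using (tendsto_pow_atTop_nhds_zero_of_lt_one hκ hc.c3).mul_const (2 * r₀)
      obtain ⟨N, hN⟩ := Filter.eventually_atTop.1 (hlim.eventually (gt_mem_nhds hδ))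
      exact ⟨N, fun z₀ hz j hj => (key z₀ hz j).2.trans (hN j hj).le⟩
  · have hden : 0 < 1 - (Q + L * M) := by linarith [hc.c3]
    have hL0 := hc.L0
    set D := (1 + L) * (2 * M) / (1 - (Q + L * M)) with hD
    have hD0 : 0 ≤ D := by positivity
    refine (LipschitzOnWith.of_dist_le_mul (K := ⟨D + L, by positivity⟩) ?_).continuousOn
    rintro ⟨⟨ω, ε⟩, x⟩ ⟨⟨hω, hε⟩, -⟩ ⟨⟨ω', ε'⟩, x'⟩ ⟨⟨hω', hε'⟩, -⟩
    simp only at hω hε hω' hε'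
    obtain ⟨h1, h2, h3⟩ := hΦ ω ε hω hε
    obtain ⟨h1', h2', h3'⟩ := hΦ ω' ε' hω' hε'
    set d := dist (ω', ε') (ω, ε) with hd
    have hd0 : 0 ≤ d := dist_nonneg
    have hdω : |ω' - ω| ≤ d := by rw [hd, Prod.dist_eq]; exact le_max_left _ _
    have hdε : |ε' - ε| ≤ d := by rw [hd, Prod.dist_eq]; exact le_max_right _ _
    have cω : |ω| ≤ 1 := by rw [abs_of_nonneg hω.1]; exact hω.2
    have cω' : |ω'| ≤ 1 := by rw [abs_of_nonneg hω'.1]; exact hω'.2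
    have cε := habs ε hε
    have cε' := habs ε' hε'
    have hn : ∀ (x : Euc k₁) (y : Euc k₂),
        ‖((ω', ε', x, y) - (ω, ε, x, y) : ℝ × ℝ × Euc k₁ × Euc k₂)‖ ≤ d := by
      intro x y
      simp [Prod.norm_def]
      exact ⟨hdω, hdε⟩
    have hb1 : ∀ (x : Euc k₁) (y : Euc k₂), ‖y‖ ≤ r₀ → ‖β ω' ε' x y - β ω ε x y‖ ≤ M * d := by
      intro x y hy
      exact (hβ.lip ω' ε' ω ε x x y y (by linarith) (by linarith) (by linarith) (by linarith)
        (by linarith) (by linarith)).trans (mul_le_mul_of_nonneg_left (hn x y) hM0)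
    have ha1 : ∀ (x : Euc k₁) (y : Euc k₂), ‖y‖ ≤ r₀ →
        ‖ω' • α ω' ε' x y - ω • α ω ε x y‖ ≤ 2 * M * d := by
      intro x y hy
      have s1 : ‖α ω' ε' x y - α ω ε x y‖ ≤ M * d :=
        (hα.lip ω' ε' ω ε x x y y (by linarith) (by linarith) (by linarith) (by linarith)
        (by linarith) (by linarith)).trans (mul_le_mul_of_nonneg_left (hn x y) hM0)
      have s2 : ‖α ω' ε' x y‖ ≤ M :=
        hα.b0 ω' ε' x y (by linarith) (by linarith) (by linarith)
      have s3 : ω' • α ω' ε' x y - ω • α ω ε x y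
          = (ω' - ω) • α ω' ε' x y + ω • (α ω' ε' x y - α ω ε x y) := by
        module
      rw [s3]
      have s4 := smul_norm_le_one cω (α ω' ε' x y - α ω ε x y)
      have s5 : ‖(ω' - ω) • α ω' ε' x y‖ ≤ d * M := by
        rw [norm_smul, Real.norm_eq_abs]; gcongr
      refine (norm_add_le _ _).trans ?_
      linarith
    have hcmp := compare (δ := 2 * M * d) (hgood ω' hω' ε' hε') hc h1' h2' h1.b
      (a' := fun z : Euc k₁ × Euc k₂ => ω • α ω ε z.1 z.2)
      (b' := fun z : Euc k₁ × Euc k₂ => β ω ε z.1 z.2) h2 h3 (fun x => ha1 x _ (h1.b x))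
      (fun x => by
        rw [norm_sub_rev]
        refine (hb1 x _ (h1.b x)).trans ?_
        have := mul_nonneg hM0 hd0
        linarith) x
    have eD : (1 + L) * (2 * M * d) / (1 - (Q + L * M)) = D * d := by rw [hD]; ring
    rw [eD] at hcmp
    have hlx := h1'.lip x x'
    rw [dist_eq_norm]
    have htri := norm_add_le (Φ ω ε x - Φ ω' ε' x) (Φ ω' ε' x - Φ ω' ε' x')
    rw [sub_add_sub_cancel] at htri
    set dd := dist (((ω, ε), x) : (ℝ × ℝ) × Euc k₁) ((ω', ε'), x') with hdd
    have g1 : d ≤ dd := by rw [hd, dist_comm, hdd, Prod.dist_eq (x := ((ω, ε), x))]; exact le_max_left _ _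
    have g2 : ‖x - x'‖ ≤ dd := by
      rw [← dist_eq_norm, hdd, Prod.dist_eq (x := ((ω, ε), x))]; exact le_max_right _ _
    have g3 := mul_le_mul_of_nonneg_left g1 hD0
    have g4 := mul_le_mul_of_nonneg_left g2 hL0
    change ‖Φ ω ε x - Φ ω' ε' x'‖ ≤ (D + L) * dd
    linarith
  · intro ω hω x
    have h0e : (0 : ℝ) ∈ Ioo (-e) e := ⟨by linarith, he0⟩
    have := huniq ω hω 0 h0e (fun _ => 0) (fun x => by simpa using hr0.le) ?_
    · rw [← this]
    · have hb : ∀ x, β ω 0 x 0 = 0 := fun x => by rw [hA2β ω 0 x 0, hA20]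
      ext ⟨x', y'⟩
      constructor
      · rintro ⟨⟨x, y⟩, hy, hxy⟩
        have hy' : y = 0 := hy
        subst hy'
        rw [← hxy]
        exact hb x
      · intro hy
        have hy' : y' = 0 := hy
        subst hy'
        refine ⟨(x' - ω • α ω 0 0 0, 0), rfl, Prod.ext ?_ (hb _)⟩
        change x' - ω • α ω 0 0 0 + ω • α ω 0 (x' - ω • α ω 0 0 0) 0 = x'
        rw [hA2α ω ω (x' - ω • α ω 0 0 0) 0 0]
        abel
end

section
/- (Lemma 2.2) Under assumptions (A1) and (A2), for every δ > 0 there exists λ₀ > 0 such that for every λ ∈ (0,λ₀]: ‖tα_λ(ω,ε,x,y)‖ + ‖D tα_λ(ω,ε,x,y)‖ ≤ δ and ‖tβ_λ(ω,ε,x,y)‖ + ‖D tβ_λ(ω,ε,x,y)‖ ≤ δ for all ω ∈ [−1/λ, 2/λ], ε ∈ (−r₁,r₁), x ∈ ℝ^{k₁}, and ‖y‖ ≤ r₁, where D denotes the total derivative with respect to (ω,ε,x,y). -/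
open Set

/-- `tα_λ(ω,ε,x,y) = (0, 0, λω·(α(λω,λ²ε,x,λy) − α(0)))`. -/
noncomputable def tAl {k₁ k₂ : ℕ} (α : ℝ → ℝ → Euc k₁ → Euc k₂ → Euc k₁) (l : ℝ)
    (p : ℝ × ℝ × Euc k₁ × Euc k₂) : ℝ × ℝ × Euc k₁ :=
  (0, 0, (l * p.1) • (α (l * p.1) (l ^ 2 * p.2.1) p.2.2.1 (l • p.2.2.2) - α 0 0 0 0))

/-- `tβ_λ(ω,ε,x,y) = (1/λ)·β(λω,λ²ε,x,λy) − B y` where `B = β_y(0)`. -/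
noncomputable def tBl {k₁ k₂ : ℕ} (β : ℝ → ℝ → Euc k₁ → Euc k₂ → Euc k₂) (l : ℝ)
    (p : ℝ × ℝ × Euc k₁ × Euc k₂) : Euc k₂ :=
  (1 / l) • β (l * p.1) (l ^ 2 * p.2.1) p.2.2.1 (l • p.2.2.2) -
    fderiv ℝ (fun y : Euc k₂ => β 0 0 0 y) 0 p.2.2.2

section helpers

variable {X Y F : Type*} [NormedAddCommGroup X] [NormedSpace ℝ X]
  [NormedAddCommGroup Y] [NormedSpace ℝ Y] [NormedAddCommGroup F] [NormedSpace ℝ F]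

def KK (X Y : Type*) [NormedAddCommGroup X] [NormedAddCommGroup Y] (C : ℝ) :
    Set (ℝ × ℝ × X × Y) := {z | |z.1| ≤ C ∧ |z.2.1| ≤ C ∧ ‖z.2.2.2‖ ≤ C}

lemma KK_convex (C : ℝ) : Convex ℝ (KK X Y C) := by
  have h1 := (convex_closedBall (0:ℝ) C).linear_preimage
    (LinearMap.fst ℝ ℝ (ℝ × X × Y))
  have h2 := (convex_closedBall (0:ℝ) C).linear_preimage
    ((LinearMap.fst ℝ ℝ (X × Y)).comp (LinearMap.snd ℝ ℝ (ℝ × X × Y)))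
  have h3 := (convex_closedBall (0:Y) C).linear_preimage
    ((LinearMap.snd ℝ X Y).comp ((LinearMap.snd ℝ ℝ (X × Y)).comp
      (LinearMap.snd ℝ ℝ (ℝ × X × Y))))
  have e : ∀ z : ℝ × ℝ × X × Y, z ∈ KK X Y C ↔ z ∈
      ((LinearMap.fst ℝ ℝ (ℝ × X × Y)) ⁻¹' Metric.closedBall 0 C ∩
        ((LinearMap.fst ℝ ℝ (X × Y)).comp (LinearMap.snd ℝ ℝ (ℝ × X × Y))) ⁻¹'
          Metric.closedBall 0 C) ∩
      ((LinearMap.snd ℝ X Y).comp ((LinearMap.snd ℝ ℝ (X × Y)).comp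
        (LinearMap.snd ℝ ℝ (ℝ × X × Y)))) ⁻¹' Metric.closedBall 0 C := by
    intro z
    simp [KK, and_assoc]
  rw [Set.ext e]
  exact (h1.inter h2).inter h3

lemma gen (f : ℝ × ℝ × X × Y → F) (hf : ContDiff ℝ 2 f) (C M r l : ℝ)
    (hr : 0 ≤ r) (hrC : r ≤ C) (hC : 2 ≤ C) (hl : 0 < l) (hl1 : l ≤ 1)
    (hM : ∀ z ∈ KK X Y C, ∀ i : ℕ, i ≤ 2 → ‖iteratedFDeriv ℝ i f z‖ ≤ M)
    (h0 : ∀ (ω ω' : ℝ) (x x' : X) (y : Y), f (ω, 0, x, y) = f (ω', 0, x', y))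
    (w e : ℝ) (x : X) (y : Y) (hw : |w| ≤ 2) (he : |e| ≤ r) (hy : ‖y‖ ≤ r) :
    0 ≤ M ∧
    ‖f (w, l ^ 2 * e, x, l • y) - f (0, 0, 0, l • y)‖ ≤ M * (l ^ 2 * r) ∧
    ‖f (w, l ^ 2 * e, x, l • y) - f 0‖ ≤ M * (l * r) ∧
    (∀ a c, ‖fderiv ℝ f (w, l ^ 2 * e, x, l • y) (a, 0, c, 0)‖
      ≤ M * (l ^ 2 * r) * max |a| ‖c‖) ∧
    (∀ v, ‖fderiv ℝ f (w, l ^ 2 * e, x, l • y) v‖ ≤ M * ‖v‖) ∧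
    (∀ d, ‖fderiv ℝ f (w, l ^ 2 * e, x, l • y) (0, 0, 0, d) - fderiv ℝ f 0 (0, 0, 0, d)‖
      ≤ M * (l * r) * ‖d‖) ∧
    ‖f (0, 0, 0, l • y) - f 0 - fderiv ℝ f 0 (0, 0, 0, l • y)‖ ≤ M * (l * r) * (l * r) := by
  have hM1 : ∀ z ∈ KK X Y C, ‖fderiv ℝ f z‖ ≤ M := by
    intro z hz
    have := hM z hz 1 (by norm_num)
    rwa [← zero_add 1, ← norm_iteratedFDeriv_fderiv, norm_iteratedFDeriv_zero] at this
  have hM2 : ∀ z ∈ KK X Y C, ‖fderiv ℝ (fderiv ℝ f) z‖ ≤ M := by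
    intro z hz
    have := hM z hz (0 + 1 + 1) (by norm_num)
    rwa [← norm_iteratedFDeriv_fderiv, ← norm_iteratedFDeriv_fderiv,
      norm_iteratedFDeriv_zero] at this
  have hd : Differentiable ℝ f := hf.differentiable (by norm_num)
  have hd2 : Differentiable ℝ (fderiv ℝ f) :=
    (hf.fderiv_right (m := 1) (by norm_num)).differentiable (by norm_num)
  have lip1 : ∀ z ∈ KK X Y C, ∀ z' ∈ KK X Y C, ‖f z' - f z‖ ≤ M * ‖z' - z‖ := fun z hz z' hz' =>
    (KK_convex C).norm_image_sub_le_of_norm_fderiv_le (fun x _ => hd x) hM1 hz hz'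
  have lip2 : ∀ z ∈ KK X Y C, ∀ z' ∈ KK X Y C,
      ‖fderiv ℝ f z' - fderiv ℝ f z‖ ≤ M * ‖z' - z‖ := fun z hz z' hz' =>
    (KK_convex C).norm_image_sub_le_of_norm_fderiv_le (fun x _ => hd2 x) hM2 hz hz'
  have hl2 : l ^ 2 ≤ l := by nlinarith
  have hly : ‖l • y‖ ≤ l * r := by
    rw [norm_smul, Real.norm_of_nonneg hl.le]; gcongr
  have hlr : l * r ≤ r := by nlinarith
  have hle : |l ^ 2 * e| ≤ l ^ 2 * r := by
    rw [abs_mul, abs_of_nonneg (by positivity : 0 ≤ l ^ 2)]; gcongr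
  have hl2r : l ^ 2 * r ≤ l * r := by gcongr
  have hlr0 : 0 ≤ l * r := by positivity
  have hl2r0 : 0 ≤ l ^ 2 * r := by positivity
  have hq : (w, l ^ 2 * e, x, l • y) ∈ KK X Y C := ⟨by simpa using by linarith, by
    show |l ^ 2 * e| ≤ C
    linarith, by show ‖l • y‖ ≤ C; linarith⟩
  have hq1 : (w, 0, x, l • y) ∈ KK X Y C := ⟨by simpa using by linarith, by
    simpa using by linarith, by show ‖l • y‖ ≤ C; linarith⟩
  have hq0 : (w, 0, x, 0) ∈ KK X Y C := ⟨by simpa using by linarith, by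
    simpa using by linarith, by simpa using by linarith⟩
  have h00 : (0 : ℝ × ℝ × X × Y) ∈ KK X Y C := ⟨by simpa using by linarith, by
    simpa using by linarith, by simpa using by linarith⟩
  have hM0 : 0 ≤ M := (norm_nonneg _).trans (hM1 0 h00)
  have n1 : ‖((w, l ^ 2 * e, x, l • y) : ℝ × ℝ × X × Y) - (w, 0, x, l • y)‖ ≤ l ^ 2 * r := by
    have hz : ((w, l ^ 2 * e, x, l • y) : ℝ × ℝ × X × Y) - (w, 0, x, l • y)
        = (0, l ^ 2 * e, 0, 0) := by
      ext <;> simp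
    rw [hz]
    simp only [Prod.norm_mk, norm_zero]
    exact max_le hl2r0 (max_le hle (max_le hl2r0 hl2r0))
  have n0 : ‖((w, l ^ 2 * e, x, l • y) : ℝ × ℝ × X × Y) - (w, 0, x, 0)‖ ≤ l * r := by
    simp only [Prod.mk_sub_mk, Prod.norm_mk, sub_self, sub_zero, norm_zero, max_le_iff]
    exact ⟨hlr0, hle.trans hl2r, hlr0, hly⟩
  refine ⟨hM0, ?_, ?_, ?_, ?_, ?_, ?_⟩
  · rw [h0 0 w 0 x]
    exact (lip1 _ hq1 _ hq).trans (by gcongr)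
  · have : f 0 = f (w, 0, x, 0) := h0 0 w 0 x 0
    rw [this]
    exact (lip1 _ hq0 _ hq).trans (by gcongr)
  · intro a c
    have hz : fderiv ℝ f (w, 0, x, l • y) (a, 0, c, 0) = 0 := by
      have h := ((hd (w, 0, x, l • y)).hasFDerivAt.hasLineDerivAt (a, 0, c, 0)).lineDeriv
      rw [← h, lineDeriv]
      have : (fun t : ℝ => f ((w, 0, x, l • y) + t • (a, 0, c, 0)))
          = fun _ => f (w, 0, x, l • y) := by
        funext t
        simp only [Prod.smul_mk, Prod.mk_add_mk, smul_zero, add_zero]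
        exact h0 _ _ _ _ _
      rw [this]; simp
    have h1 := (lip2 _ hq1 _ hq).trans (mul_le_mul_of_nonneg_left n1 hM0)
    have h2 := ContinuousLinearMap.le_of_opNorm_le _ h1 (a, 0, c, 0)
    rw [sub_apply, hz, sub_zero] at h2
    refine h2.trans (le_of_eq ?_)
    congr 1
    simp [Prod.norm_mk]
  · intro v
    exact ContinuousLinearMap.le_of_opNorm_le _ (hM1 _ hq) v
  · intro d
    have hz : fderiv ℝ f 0 (0, 0, 0, d) = fderiv ℝ f (w, 0, x, 0) (0, 0, 0, d) := by
      have h := ((hd (w, 0, x, 0)).hasFDerivAt.hasLineDerivAt (0, 0, 0, d)).lineDeriv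
      have h' := ((hd 0).hasFDerivAt.hasLineDerivAt (0, 0, 0, d)).lineDeriv
      rw [← h, ← h', lineDeriv, lineDeriv]
      congr 1
      funext t
      simp only [Prod.smul_mk, Prod.mk_add_mk, smul_zero, add_zero, zero_add]
      exact h0 _ _ _ _ _
    rw [hz, ← sub_apply]
    have h1 := (lip2 _ hq0 _ hq).trans (mul_le_mul_of_nonneg_left n0 hM0)
    refine (ContinuousLinearMap.le_of_opNorm_le _ h1 _).trans (le_of_eq ?_)
    congr 1
    simp [Prod.norm_mk]
  · have hsub : Metric.closedBall (0 : ℝ × ℝ × X × Y) (l * r) ⊆ KK X Y C := by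
      rintro ⟨a, b, c, d⟩ hz
      simp only [mem_closedBall_zero_iff, Prod.norm_mk, max_le_iff, Real.norm_eq_abs] at hz
      obtain ⟨z1, z2, z3, z4⟩ := hz
      exact ⟨by simpa using by linarith, by simpa using by linarith, by simpa using by linarith⟩
    have hn : ‖((0, 0, 0, l • y) : ℝ × ℝ × X × Y)‖ ≤ l * r := by
      simp only [Prod.norm_mk, norm_zero, max_le_iff]
      exact ⟨hlr0, hlr0, hlr0, hly⟩
    have h := (convex_closedBall (0 : ℝ × ℝ × X × Y) (l * r)).norm_image_sub_le_of_norm_fderiv_le'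
      (f := f) (φ := fderiv ℝ f 0) (C := M * (l * r)) (x := 0) (y := (0, 0, 0, l • y))
      (fun x _ => hd x) (fun z hz => by
        refine (lip2 _ h00 _ (hsub hz)).trans ?_
        rw [sub_zero]
        rw [mem_closedBall_zero_iff] at hz
        gcongr) (by simpa using hlr0) (by simpa using hn)
    rw [sub_zero] at h
    exact h.trans (by gcongr)

/-- The scaling map. -/
noncomputable def LL (X Y : Type*) [NormedAddCommGroup X] [NormedSpace ℝ X]
    [NormedAddCommGroup Y] [NormedSpace ℝ Y] (l : ℝ) :
    (ℝ × ℝ × X × Y) →L[ℝ] (ℝ × ℝ × X × Y) :=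
  (l • ContinuousLinearMap.id ℝ ℝ).prodMap
    ((l ^ 2 • ContinuousLinearMap.id ℝ ℝ).prodMap
      ((ContinuousLinearMap.id ℝ X).prodMap (l • ContinuousLinearMap.id ℝ Y)))

lemma LL_apply (l a b : ℝ) (c : X) (d : Y) :
    LL X Y l (a, b, c, d) = (l * a, l ^ 2 * b, c, l • d) := rfl

lemma split (T : (ℝ × ℝ × X × Y) →L[ℝ] F) (l a b : ℝ) (c : X) (d : Y) :
    T (LL X Y l (a, b, c, d)) = T (l * a, 0, c, 0) + l ^ 2 • T (0, b, 0, 0)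
      + l • T (0, 0, 0, d) := by
  rw [LL_apply, ← map_smul, ← map_smul, ← map_add, ← map_add]
  simp

lemma genA (f : ℝ × ℝ × X × Y → F) (hf : ContDiff ℝ 2 f) (C M r l : ℝ)
    (hr : 0 ≤ r) (hrC : r ≤ C) (hC : 2 ≤ C) (hl : 0 < l) (hl1 : l ≤ 1)
    (hM : ∀ z ∈ KK X Y C, ∀ i : ℕ, i ≤ 2 → ‖iteratedFDeriv ℝ i f z‖ ≤ M)
    (h0 : ∀ (ω ω' : ℝ) (x x' : X) (y : Y), f (ω, 0, x, y) = f (ω', 0, x', y))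
    (w e : ℝ) (x : X) (y : Y) (hw : |l * w| ≤ 2) (he : |e| ≤ r) (hy : ‖y‖ ≤ r)
    (g : ℝ × ℝ × X × Y → ℝ × ℝ × F)
    (hg : g = fun p => (0, 0, (l * p.1) • (f (LL X Y l p) - f 0))) :
    ‖g (w, e, x, y)‖ + ‖fderiv ℝ g (w, e, x, y)‖ ≤ l * (5 * M * r + 4 * M) := by
  obtain ⟨hM0, -, b2, b3, b4, -, -⟩ :=
    gen f hf C M r l hr hrC hC hl hl1 hM h0 (l * w) e x y hw he hy
  have hd : Differentiable ℝ f := hf.differentiable (by norm_num)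
  rw [← LL_apply] at b2 b3 b4
  set p : ℝ × ℝ × X × Y := (w, e, x, y) with hp
  have hl2 : l ^ 2 ≤ l := by nlinarith
  have hfd : HasFDerivAt (fun p : ℝ × ℝ × X × Y => f (LL X Y l p) - f 0)
      ((fderiv ℝ f (LL X Y l p)).comp (LL X Y l)) p :=
    ((hd _).hasFDerivAt.comp p (LL X Y l).hasFDerivAt).sub_const _
  have hs : HasFDerivAt (fun p : ℝ × ℝ × X × Y => l * p.1)
      (l • ContinuousLinearMap.fst ℝ ℝ (ℝ × X × Y)) p :=
    (hasFDerivAt_fst).const_mul l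
  have hG := (hasFDerivAt_const (0:ℝ) p).prodMk
    ((hasFDerivAt_const (0:ℝ) p).prodMk (hs.smul hfd))
  replace hG : HasFDerivAt g _ p := hg ▸ hG
  have hG' := hG.fderiv
  have hv : ‖g p‖ ≤ 2 * (M * (l * r)) := by
    rw [hg]
    simp only [Prod.norm_mk, norm_zero, norm_smul, Real.norm_eq_abs]
    have : |l * p.1| * ‖f (LL X Y l p) - f 0‖ ≤ 2 * (M * (l * r)) := by gcongr
    simp only [max_le_iff]
    exact ⟨by positivity, by positivity, this⟩
  have hdv : ‖fderiv ℝ g p‖ ≤ l * (3 * M * r + 4 * M) := by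
    rw [hG']
    refine ContinuousLinearMap.opNorm_le_bound _ (by positivity) ?_
    rintro ⟨a, b, c, d⟩
    set v : ℝ × ℝ × X × Y := (a, b, c, d) with hv
    have ha : |a| ≤ ‖v‖ := norm_fst_le v
    have hb : |b| ≤ ‖v‖ := (norm_fst_le v.2).trans (norm_snd_le v)
    have hc : ‖c‖ ≤ ‖v‖ := (norm_fst_le v.2.2).trans ((norm_snd_le v.2).trans (norm_snd_le v))
    have hdd : ‖d‖ ≤ ‖v‖ := (norm_snd_le v.2.2).trans ((norm_snd_le v.2).trans (norm_snd_le v))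
    have hm : max |l * a| ‖c‖ ≤ ‖v‖ := by
      refine max_le ?_ hc
      rw [abs_mul, abs_of_pos hl]; nlinarith [abs_nonneg a]
    have e1 : ‖fderiv ℝ f (LL X Y l p) (l * a, 0, c, 0)‖ ≤ l * (M * r * ‖v‖) := by
      refine (b3 _ _).trans ?_
      calc _ ≤ M * (l * r) * ‖v‖ := by gcongr
        _ = _ := by ring
    have e2 : ‖l ^ 2 • fderiv ℝ f (LL X Y l p) (0, b, 0, 0)‖ ≤ l * (M * ‖v‖) := by
      rw [norm_smul, Real.norm_of_nonneg (by positivity)]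
      have := b4 (0, b, 0, 0)
      have h2 : ‖((0, b, 0, 0) : ℝ × ℝ × X × Y)‖ ≤ ‖v‖ := by
        simpa [Prod.norm_mk] using hb
      calc _ ≤ l * (M * ‖((0, b, 0, 0) : ℝ × ℝ × X × Y)‖) := by gcongr
        _ ≤ _ := by gcongr
    have e3 : ‖l • fderiv ℝ f (LL X Y l p) (0, 0, 0, d)‖ ≤ l * (M * ‖v‖) := by
      rw [norm_smul, Real.norm_of_nonneg (by positivity)]
      have := b4 (0, 0, 0, d)
      have h2 : ‖((0, 0, 0, d) : ℝ × ℝ × X × Y)‖ ≤ ‖v‖ := by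
        simpa [Prod.norm_mk] using hdd
      calc _ ≤ l * (M * ‖((0, 0, 0, d) : ℝ × ℝ × X × Y)‖) := by gcongr
        _ ≤ _ := by gcongr
    have e4 : ‖fderiv ℝ f (LL X Y l p) (LL X Y l v)‖ ≤ l * (M * r * ‖v‖ + 2 * (M * ‖v‖)) := by
      rw [hv, split, ← hv]
      refine (norm_add₃_le).trans ?_
      linarith
    have e5 : ‖(l * w) • fderiv ℝ f (LL X Y l p) (LL X Y l v)
        + (l * a) • (f (LL X Y l p) - f 0)‖ ≤ l * (3 * M * r + 4 * M) * ‖v‖ := by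
      refine (norm_add_le _ _).trans ?_
      rw [norm_smul, norm_smul, Real.norm_eq_abs, Real.norm_eq_abs, abs_mul l a, abs_of_pos hl]
      have i1 : |l * w| * ‖fderiv ℝ f (LL X Y l p) (LL X Y l v)‖
          ≤ 2 * (l * (M * r * ‖v‖ + 2 * (M * ‖v‖))) := by gcongr
      have i2 : l * |a| * ‖f (LL X Y l p) - f 0‖ ≤ l * ‖v‖ * (M * (1 * r)) := by
        gcongr
        exact b2.trans (by gcongr)
      linarith
    have e6 : 0 ≤ l * (3 * M * r + 4 * M) * ‖v‖ := by positivity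
    simp only [ContinuousLinearMap.prod_apply, Prod.norm_mk, ContinuousLinearMap.zero_apply,
      norm_zero, max_le_iff]
    refine ⟨e6, e6, ?_⟩
    simpa using e5
  calc _ ≤ _ := add_le_add hv hdv
    _ = _ := by ring

lemma genB (f : ℝ × ℝ × X × Y → F) (hf : ContDiff ℝ 2 f) (C M r l : ℝ)
    (hr : 0 ≤ r) (hrC : r ≤ C) (hC : 2 ≤ C) (hl : 0 < l) (hl1 : l ≤ 1)
    (hM : ∀ z ∈ KK X Y C, ∀ i : ℕ, i ≤ 2 → ‖iteratedFDeriv ℝ i f z‖ ≤ M)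
    (h0 : ∀ (ω ω' : ℝ) (x x' : X) (y : Y), f (ω, 0, x, y) = f (ω', 0, x', y))
    (hf0 : f 0 = 0)
    (w e : ℝ) (x : X) (y : Y) (hw : |l * w| ≤ 2) (he : |e| ≤ r) (hy : ‖y‖ ≤ r)
    (g : ℝ × ℝ × X × Y → F)
    (hg : g = fun p => (1 / l) • f (LL X Y l p) -
      fderiv ℝ (fun y : Y => f (0, 0, 0, y)) 0 p.2.2.2) :
    ‖g (w, e, x, y)‖ + ‖fderiv ℝ g (w, e, x, y)‖ ≤ l * (3 * M * r + M + M * r ^ 2) := by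
  obtain ⟨hM0, b1, -, b3, b4, b5, b6⟩ :=
    gen f hf C M r l hr hrC hC hl hl1 hM h0 (l * w) e x y hw he hy
  have hd : Differentiable ℝ f := hf.differentiable (by norm_num)
  rw [hf0, sub_zero] at b6
  rw [← LL_apply] at b1 b3 b4 b5
  set B := fderiv ℝ (fun y : Y => f (0, 0, 0, y)) 0 with hB
  have hBd : ∀ d, fderiv ℝ f 0 (0, 0, 0, d) = B d := by
    intro d
    have h1 : HasFDerivAt (fun y : Y => ((0, 0, 0, y) : ℝ × ℝ × X × Y))
      ((0 : Y →L[ℝ] ℝ).prod ((0 : Y →L[ℝ] ℝ).prod ((0 : Y →L[ℝ] X).prod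
        (ContinuousLinearMap.id ℝ Y)))) 0 :=
      (hasFDerivAt_const _ _).prodMk ((hasFDerivAt_const _ _).prodMk
        ((hasFDerivAt_const _ _).prodMk (hasFDerivAt_id _)))
    have h2 := (hd (0, 0, 0, 0)).hasFDerivAt.comp (0 : Y) h1
    have h3 : B = _ := h2.fderiv
    rw [h3]
    rfl
  set p : ℝ × ℝ × X × Y := (w, e, x, y) with hp
  have hG : HasFDerivAt g ((1 / l) • ((fderiv ℝ f (LL X Y l p)).comp (LL X Y l)) -
      B.comp ((ContinuousLinearMap.snd ℝ X Y).comp ((ContinuousLinearMap.snd ℝ ℝ (X × Y)).comp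
      (ContinuousLinearMap.snd ℝ ℝ (ℝ × X × Y))))) p := by
    rw [hg]
    exact (((hd _).hasFDerivAt.comp p (LL X Y l).hasFDerivAt).const_smul (1 / l)).sub
      (ContinuousLinearMap.hasFDerivAt
      (B.comp ((ContinuousLinearMap.snd ℝ X Y).comp ((ContinuousLinearMap.snd ℝ ℝ (X × Y)).comp
      (ContinuousLinearMap.snd ℝ ℝ (ℝ × X × Y))))))
  have hl' : 1 / l * l = 1 := by field_simp
  have hv : ‖g p‖ ≤ l * (M * r + M * r ^ 2) := by
    have : g p = (1 / l) • ((f (LL X Y l p) - f (0, 0, 0, l • y)) +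
        (f (0, 0, 0, l • y) - fderiv ℝ f 0 (0, 0, 0, l • y))) := by
      rw [hg, hBd, map_smul, sub_add_sub_cancel, smul_sub, smul_smul, hl', one_smul]
    rw [this, norm_smul, Real.norm_of_nonneg (by positivity)]
    calc _ ≤ 1 / l * (M * (l ^ 2 * r) + M * (l * r) * (l * r)) := by
          gcongr
          exact (norm_add_le _ _).trans (add_le_add b1 b6)
      _ = _ := by field_simp
  have hdv : ‖fderiv ℝ g p‖ ≤ l * (2 * M * r + M) := by
    rw [hG.fderiv]
    refine ContinuousLinearMap.opNorm_le_bound _ (by positivity) ?_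
    rintro ⟨a, b, c, d⟩
    set v : ℝ × ℝ × X × Y := (a, b, c, d) with hv
    have ha : |a| ≤ ‖v‖ := norm_fst_le v
    have hb : |b| ≤ ‖v‖ := (norm_fst_le v.2).trans (norm_snd_le v)
    have hc : ‖c‖ ≤ ‖v‖ := (norm_fst_le v.2.2).trans ((norm_snd_le v.2).trans (norm_snd_le v))
    have hdd : ‖d‖ ≤ ‖v‖ := (norm_snd_le v.2.2).trans ((norm_snd_le v.2).trans (norm_snd_le v))
    have hm : max |l * a| ‖c‖ ≤ ‖v‖ := by
      refine max_le ?_ hc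
      rw [abs_mul, abs_of_pos hl]; nlinarith [abs_nonneg a]
    have e1 : ‖(1 / l) • fderiv ℝ f (LL X Y l p) (l * a, 0, c, 0)‖ ≤ l * (M * r * ‖v‖) := by
      rw [norm_smul, Real.norm_of_nonneg (by positivity)]
      calc _ ≤ 1 / l * (M * (l ^ 2 * r) * ‖v‖) := by
            gcongr
            exact (b3 _ _).trans (by gcongr)
        _ = _ := by field_simp
    have e2 : ‖l • fderiv ℝ f (LL X Y l p) (0, b, 0, 0)‖ ≤ l * (M * ‖v‖) := by
      rw [norm_smul, Real.norm_of_nonneg (by positivity)]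
      have := b4 (0, b, 0, 0)
      have h2 : ‖((0, b, 0, 0) : ℝ × ℝ × X × Y)‖ ≤ ‖v‖ := by
        simpa [Prod.norm_mk] using hb
      calc _ ≤ l * (M * ‖((0, b, 0, 0) : ℝ × ℝ × X × Y)‖) := by gcongr
        _ ≤ _ := by gcongr
    have e3 : ‖fderiv ℝ f (LL X Y l p) (0, 0, 0, d) - B d‖ ≤ l * (M * r * ‖v‖) := by
      rw [← hBd]
      calc _ ≤ M * (l * r) * ‖v‖ := (b5 d).trans (by gcongr)
        _ = _ := by ring
    have key : (1 / l) • fderiv ℝ f (LL X Y l p) (LL X Y l v) - B d =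
        (1 / l) • fderiv ℝ f (LL X Y l p) (l * a, 0, c, 0) +
        l • fderiv ℝ f (LL X Y l p) (0, b, 0, 0) +
        (fderiv ℝ f (LL X Y l p) (0, 0, 0, d) - B d) := by
      have hl'' : 1 / l * l ^ 2 = l := by field_simp
      rw [hv, split, smul_add, smul_add, smul_smul, smul_smul, hl', hl'', one_smul]
      abel
    show ‖(1 / l) • fderiv ℝ f (LL X Y l p) (LL X Y l v) - B d‖ ≤ _
    rw [key]
    refine norm_add₃_le.trans ?_
    linarith
  calc _ ≤ _ := add_le_add hv hdv
    _ = _ := by ring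

end helpers

/-- Lemma 2.2: smallness of `tα_λ`, `tβ_λ` and their total derivatives. -/
theorem stmt1 (k₁ k₂ : ℕ) (r₁ : ℝ) (hr₁ : 0 < r₁)
    (α : ℝ → ℝ → Euc k₁ → Euc k₂ → Euc k₁)
    (β : ℝ → ℝ → Euc k₁ → Euc k₂ → Euc k₂)
    (hαC2 : ContDiff ℝ 2 (fun p : ℝ × ℝ × Euc k₁ × Euc k₂ => α p.1 p.2.1 p.2.2.1 p.2.2.2))
    (hβC2 : ContDiff ℝ 2 (fun p : ℝ × ℝ × Euc k₁ × Euc k₂ => β p.1 p.2.1 p.2.2.1 p.2.2.2))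
    (hA1 : ∀ C : ℝ, ∃ M : ℝ, ∀ (ω ε : ℝ) (x : Euc k₁) (y : Euc k₂),
      |ω| ≤ C → |ε| ≤ C → ‖y‖ ≤ C → ∀ i : ℕ, i ≤ 2 →
        ‖iteratedFDeriv ℝ i (fun p : ℝ × ℝ × Euc k₁ × Euc k₂ => α p.1 p.2.1 p.2.2.1 p.2.2.2)
            (ω, ε, x, y)‖ ≤ M ∧
        ‖iteratedFDeriv ℝ i (fun p : ℝ × ℝ × Euc k₁ × Euc k₂ => β p.1 p.2.1 p.2.2.1 p.2.2.2)
            (ω, ε, x, y)‖ ≤ M)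
    (hA2α : ∀ (ω ω' : ℝ) (x x' : Euc k₁) (y : Euc k₂), α ω 0 x y = α ω' 0 x' y)
    (hA2β : ∀ (ω ω' : ℝ) (x x' : Euc k₁) (y : Euc k₂), β ω 0 x y = β ω' 0 x' y)
    (hA20 : β 0 0 0 0 = 0) :
    ∀ δ : ℝ, 0 < δ → ∃ l₀ : ℝ, 0 < l₀ ∧ ∀ l : ℝ, 0 < l → l ≤ l₀ →
      ∀ p : ℝ × ℝ × Euc k₁ × Euc k₂,
        p.1 ∈ Icc (-(1 / l)) (2 / l) → p.2.1 ∈ Ioo (-r₁) r₁ → ‖p.2.2.2‖ ≤ r₁ →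
          ‖tAl α l p‖ + ‖fderiv ℝ (tAl α l) p‖ ≤ δ ∧
          ‖tBl β l p‖ + ‖fderiv ℝ (tBl β l) p‖ ≤ δ := by
  intro δ hδ
  obtain ⟨M, hM⟩ := hA1 (max 2 r₁)
  have hM0 : 0 ≤ M := (norm_nonneg _).trans (hM 0 0 0 0 (by simp) (by simp) (by simp) 0 (by simp)).1
  set K : ℝ := 5 * M * r₁ + 4 * M + M * r₁ ^ 2 + 1 with hK
  have hK0 : 0 < K := by positivity
  refine ⟨min 1 (δ / K), by positivity, ?_⟩
  rintro l hl hl0 ⟨w, e, x, y⟩ hw he hy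
  have hl1 : l ≤ 1 := hl0.trans (min_le_left _ _)
  have hlK : l * K ≤ δ := (le_div_iff₀ hK0).1 (hl0.trans (min_le_right _ _))
  have hw' : |l * w| ≤ 2 := by
    obtain ⟨h1, h2⟩ := hw
    simp only at h1 h2
    have h3 := mul_le_mul_of_nonneg_left h1 hl.le
    have h4 := mul_le_mul_of_nonneg_left h2 hl.le
    have h5 : l * -(1 / l) = -1 := by field_simp
    have h6 : l * (2 / l) = 2 := by field_simp
    rw [abs_le]
    constructor <;> linarith
  have he' : |e| ≤ r₁ := abs_le.2 ⟨he.1.le, he.2.le⟩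
  have A := genA (fun p : ℝ × ℝ × Euc k₁ × Euc k₂ => α p.1 p.2.1 p.2.2.1 p.2.2.2) hαC2
    (max 2 r₁) M r₁ l hr₁.le (le_max_right _ _) (le_max_left _ _) hl hl1
    (fun z hz i hi => (hM z.1 z.2.1 z.2.2.1 z.2.2.2 hz.1 hz.2.1 hz.2.2 i hi).1)
    hA2α w e x y hw' he' hy (tAl α l) rfl
  have B := genB (fun p : ℝ × ℝ × Euc k₁ × Euc k₂ => β p.1 p.2.1 p.2.2.1 p.2.2.2) hβC2
    (max 2 r₁) M r₁ l hr₁.le (le_max_right _ _) (le_max_left _ _) hl hl1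
    (fun z hz i hi => (hM z.1 z.2.1 z.2.2.1 z.2.2.2 hz.1 hz.2.1 hz.2.2 i hi).2)
    hA2β hA20 w e x y hw' he' hy (tBl β l) rfl
  have p1 : 0 ≤ M * r₁ := by positivity
  have p2 : 0 ≤ M * r₁ ^ 2 := by positivity
  refine ⟨A.trans (le_trans ?_ hlK), B.trans (le_trans ?_ hlK)⟩
  · gcongr; linarith
  · gcongr; linarith
end

section
/- (Corollary 2.3) Under assumptions (A1)–(A3) there exists λ₀ ∈ (0,1] such that for every λ ∈ (0,λ₀] the map G_λ is a surjective C¹-diffeomorphism of ℝ×ℝ×ℝ^{k₁}×ℝ^{k₂} onto itself. -/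
open Set

/-- `G_λ(ω,ε,x,y) = (A_λ(ω,ε,x), By) + Ψ(λω,ε,y)·(tα_λ(ω,ε,x,y), tβ_λ(ω,ε,x,y))`,
written componentwise. -/
noncomputable def Glam {k₁ k₂ : ℕ} (α : ℝ → ℝ → Euc k₁ → Euc k₂ → Euc k₁)
    (β : ℝ → ℝ → Euc k₁ → Euc k₂ → Euc k₂) (Ψ : ℝ → ℝ → Euc k₂ → ℝ) (l : ℝ)
    (p : ℝ × ℝ × Euc k₁ × Euc k₂) : ℝ × ℝ × Euc k₁ × Euc k₂ :=
  (p.1, p.2.1, p.2.2.1 + (l * p.1) • α 0 0 0 0 + Ψ (l * p.1) p.2.1 p.2.2.2 • (tAl α l p).2.2,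
    fderiv ℝ (fun y : Euc k₂ => β 0 0 0 y) 0 p.2.2.2 + Ψ (l * p.1) p.2.1 p.2.2.2 • tBl β l p)


theorem approx_bij {E : Type*} [NormedAddCommGroup E] [NormedSpace ℝ E] [CompleteSpace E]
    [Nontrivial E] (L : E ≃L[ℝ] E) : ∃ c : ℝ, 0 < c ∧ ∀ P : E → E, ContDiff ℝ 1 P →
      (∀ p, ‖fderiv ℝ P p‖ ≤ c) → ∃ h : E ≃ₜ E, (∀ p, h p = L p + P p) ∧ ContDiff ℝ 1 h.symm := by
  have hN := L.nnnorm_symm_pos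
  set N := ‖(L.symm : E →L[ℝ] E)‖₊ with hNdef
  have hc : N⁻¹ / 2 < N⁻¹ := half_lt_self (by positivity)
  have key : ∀ P : E → E, Differentiable ℝ P → (∀ p, ‖fderiv ℝ P p‖₊ ≤ N⁻¹ / 2) →
      ApproximatesLinearOn (fun p => L p + P p) (L : E →L[ℝ] E) univ (N⁻¹ / 2) := by
    intro P hP hb
    rw [ApproximatesLinearOn.approximatesLinearOn_iff_lipschitzOnWith, lipschitzOnWith_univ]
    have : ((fun p => L p + P p) - ⇑(L : E →L[ℝ] E)) = P := by
      ext p; simp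
    rw [this]
    exact lipschitzWith_of_nnnorm_fderiv_le hP hb
  refine ⟨(N⁻¹ / 2 : NNReal), by positivity, fun P hP hb => ?_⟩
  have h1 := key P (hP.differentiable (by norm_num)) (fun p => hb p)
  let h := h1.toHomeomorph _ (Or.inr hc)
  have hh : ∀ p, h p = L p + P p := fun p => rfl
  refine ⟨h, hh, ?_⟩
  have inv : ∀ p, ∃ e : E ≃L[ℝ] E, (e : E →L[ℝ] E) = (L : E →L[ℝ] E) + fderiv ℝ P p := by
    intro p
    have h2 := key (fderiv ℝ P p) (fderiv ℝ P p).differentiable (fun q => by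
      rw [ContinuousLinearMap.fderiv]; exact hb p)
    let h' := h2.toHomeomorph _ (Or.inr hc)
    have hbij : Function.Bijective ((L : E →L[ℝ] E) + fderiv ℝ P p) := h'.bijective
    refine ⟨ContinuousLinearEquiv.ofBijective ((L : E →L[ℝ] E) + fderiv ℝ P p)
      (LinearMap.ker_eq_bot.2 hbij.1) (LinearMap.range_eq_top.2 hbij.2), ?_⟩
    ext x; simp
  choose e he using inv
  have hfun : (h : E → E) = fun p => L p + P p := funext hh
  refine Homeomorph.contDiff_symm (f₀' := e) h ?_ ?_
  · intro a
    rw [he, hfun]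
    exact (L.hasFDerivAt).add (hP.differentiable (by norm_num) a).hasFDerivAt
  · rw [hfun]
    exact L.contDiff.add hP

section
variable {X Y Z : Type*} [NormedAddCommGroup X] [NormedSpace ℝ X] [NormedAddCommGroup Y]
  [NormedSpace ℝ Y] [NormedAddCommGroup Z] [NormedSpace ℝ Z]

/-- scaling -/
noncomputable def scl (X Y : Type*) [NormedAddCommGroup X] [NormedSpace ℝ X]
    [NormedAddCommGroup Y] [NormedSpace ℝ Y] (l : ℝ) : (ℝ × ℝ × X × Y) →L[ℝ] (ℝ × ℝ × X × Y) :=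
  (ContinuousLinearMap.id ℝ ℝ).prodMap (((l ^ 2) • ContinuousLinearMap.id ℝ ℝ).prodMap
    ((ContinuousLinearMap.id ℝ X).prodMap (l • ContinuousLinearMap.id ℝ Y)))

theorem scl_apply (l : ℝ) (p : ℝ × ℝ × X × Y) :
    scl X Y l p = (p.1, l ^ 2 * p.2.1, p.2.2.1, l • p.2.2.2) := by
  simp [scl]; rfl

/-- inclusion of the last projection -/
noncomputable def prj (X Y : Type*) [NormedAddCommGroup X] [NormedSpace ℝ X]
    [NormedAddCommGroup Y] [NormedSpace ℝ Y] : (ℝ × ℝ × X × Y) →L[ℝ] (ℝ × ℝ × X × Y) :=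
  (0 : ℝ →L[ℝ] ℝ).prodMap ((0 : ℝ →L[ℝ] ℝ).prodMap
    ((0 : X →L[ℝ] X).prodMap (ContinuousLinearMap.id ℝ Y)))

theorem prj_apply (p : ℝ × ℝ × X × Y) :
    prj X Y p = (0, 0, 0, p.2.2.2) := by
  simp [prj]; rfl

/-- remainder -/
noncomputable def rem (f : ℝ × ℝ × X × Y → Z) (l : ℝ) (p : ℝ × ℝ × X × Y) : Z :=
  f (scl X Y l p) - f 0 - l • fderiv ℝ f 0 (prj X Y p)

theorem rem_hasFDerivAt (f : ℝ × ℝ × X × Y → Z) (hf : ContDiff ℝ 2 f) (l : ℝ)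
    (p : ℝ × ℝ × X × Y) : HasFDerivAt (rem f l)
      ((fderiv ℝ f (scl X Y l p)).comp (scl X Y l) - l • (fderiv ℝ f 0).comp (prj X Y)) p := by
  have hd := hf.differentiable (by norm_num)
  have h1 := (hd (scl X Y l p)).hasFDerivAt.comp p (scl X Y l).hasFDerivAt
  have h2 := ((fderiv ℝ f 0).comp (prj X Y)).hasFDerivAt (x := p) |>.const_smul l
  exact (h1.sub_const (f 0)).sub h2

theorem rem_bound (f : ℝ × ℝ × X × Y → Z) (hf : ContDiff ℝ 2 f)
    (hinv : ∀ (w w' : ℝ) (x x' : X) (y : Y), f (w, 0, x, y) = f (w', 0, x', y))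
    (C : ℝ) (hC : 0 ≤ C)
    (hb : ∃ M : ℝ, ∀ (w e : ℝ) (x : X) (y : Y), |w| ≤ C → |e| ≤ C → ‖y‖ ≤ C →
      ∀ i : ℕ, i ≤ 2 → ‖iteratedFDeriv ℝ i f (w, e, x, y)‖ ≤ M) :
    ∃ K : ℝ, 0 ≤ K ∧ ∀ l : ℝ, 0 < l → l ≤ 1 → ∀ (w e : ℝ) (x : X) (y : Y),
      |w| ≤ C → |e| ≤ C → ‖y‖ ≤ C →
      ‖rem f l (w, e, x, y)‖ ≤ K * l ^ 2 ∧ ‖fderiv ℝ (rem f l) (w, e, x, y)‖ ≤ K * l ^ 2 := by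
  obtain ⟨M, hM⟩ := hb
  have hd : Differentiable ℝ f := hf.differentiable (by norm_num)
  have hM0 : 0 ≤ M := (norm_nonneg _).trans
    (hM 0 0 0 0 (by simpa) (by simpa) (by simpa) 0 (by norm_num))
  have hd1 : ∀ (w e : ℝ) (x : X) (y : Y), |w| ≤ C → |e| ≤ C → ‖y‖ ≤ C →
      ‖fderiv ℝ f (w, e, x, y)‖ ≤ M := by
    intro w e x y h1 h2 h3
    have := hM w e x y h1 h2 h3 1 (by norm_num)
    rwa [norm_iteratedFDeriv_one] at this
  have hd2 : ∀ (w e : ℝ) (x : X) (y : Y), |w| ≤ C → |e| ≤ C → ‖y‖ ≤ C →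
      ‖fderiv ℝ (fderiv ℝ f) (w, e, x, y)‖ ≤ M := by
    intro w e x y h1 h2 h3
    have := hM w e x y h1 h2 h3 2 le_rfl
    rwa [← norm_iteratedFDeriv_fderiv, norm_iteratedFDeriv_one] at this
  let S : Set (ℝ × ℝ × X × Y) := {p | |p.1| ≤ C ∧ |p.2.1| ≤ C ∧ ‖p.2.2.2‖ ≤ C}
  have hS : Convex ℝ S := by
    have e : S = Metric.closedBall (0:ℝ) C ×ˢ (Metric.closedBall (0:ℝ) C ×ˢ
        ((univ : Set X) ×ˢ Metric.closedBall (0:Y) C)) := by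
      ext p; simp [S]
    rw [e]
    exact (convex_closedBall _ _).prod ((convex_closedBall _ _).prod
      (convex_univ.prod (convex_closedBall _ _)))
  have hdd : Differentiable ℝ (fderiv ℝ f) :=
    (hf.fderiv_right (m := 1) (by norm_num)).differentiable (by norm_num)
  have lip : ∀ p ∈ S, ∀ p' ∈ S, ‖fderiv ℝ f p - fderiv ℝ f p'‖ ≤ M * ‖p - p'‖ := by
    intro p hp p' hp'
    exact hS.norm_image_sub_le_of_norm_fderiv_le (fun z _ => hdd z)
      (fun z hz => hd2 _ _ _ _ hz.1 hz.2.1 hz.2.2) hp' hp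
  have z1 : ∀ (w : ℝ) (x : X) (y : Y) (a : ℝ) (u : X),
      fderiv ℝ f (w, 0, x, y) (a, 0, u, 0) = 0 := by
    intro w x y a u
    rw [← (hd _).lineDeriv_eq_fderiv, lineDeriv]
    have : (fun t : ℝ => f ((w, 0, x, y) + t • (a, 0, u, 0))) = fun _ => f (0, 0, 0, y) := by
      funext t
      simpa using hinv _ _ _ _ _
    rw [this]; simp
  have z2 : ∀ (w : ℝ) (x : X) (v : Y),
      fderiv ℝ f (w, 0, x, 0) (0, 0, 0, v) = fderiv ℝ f 0 (0, 0, 0, v) := by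
    intro w x v
    rw [← (hd _).lineDeriv_eq_fderiv, ← (hd _).lineDeriv_eq_fderiv, lineDeriv, lineDeriv]
    congr 1
    funext t
    simpa using hinv _ _ _ _ _
  have hder : ∀ l : ℝ, 0 < l → l ≤ 1 → ∀ p ∈ S,
      ‖fderiv ℝ (rem f l) p‖ ≤ (2 * M * C + M) * l ^ 2 := by
    intro l hl hl1 p hp
    obtain ⟨w, e, x, y⟩ := p
    obtain ⟨h1, h2, h3⟩ := hp
    simp only at h1 h2 h3
    have hl2 : l ^ 2 ≤ 1 := pow_le_one₀ hl.le hl1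
    have hsp : |l ^ 2 * e| ≤ l ^ 2 * C := by
      rw [abs_mul, abs_of_nonneg (by positivity)]; gcongr
    have hsy : ‖l • y‖ ≤ l * C := by
      rw [norm_smul, Real.norm_of_nonneg hl.le]; gcongr
    have hsp' : |l ^ 2 * e| ≤ C := hsp.trans (mul_le_of_le_one_left hC hl2)
    have hsy' : ‖l • y‖ ≤ C := hsy.trans (mul_le_of_le_one_left hC hl1)
    have m0 : ((w, l ^ 2 * e, x, l • y) : ℝ × ℝ × X × Y) ∈ S := ⟨h1, hsp', hsy'⟩
    have m1 : ((w, 0, x, l • y) : ℝ × ℝ × X × Y) ∈ S := ⟨h1, by simpa using hC, hsy'⟩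
    have m2 : ((w, 0, x, 0) : ℝ × ℝ × X × Y) ∈ S := ⟨h1, by simpa using hC, by simpa using hC⟩
    set D := fderiv ℝ f (w, l ^ 2 * e, x, l • y) with hDdef
    have b1 : ‖D - fderiv ℝ f (w, 0, x, l • y)‖ ≤ M * (l ^ 2 * C) := by
      refine (lip _ m0 _ m1).trans ?_
      gcongr
      simp [Prod.norm_def] 
      refine ⟨?_, by positivity⟩
      simpa [abs_mul] using hsp
    have b2 : ‖D - fderiv ℝ f (w, 0, x, 0)‖ ≤ M * (l * C) := by
      refine (lip _ m0 _ m2).trans ?_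
      gcongr
      have : l ^ 2 * C ≤ l * C := by
        gcongr; nlinarith
      have := hsp.trans this
      simp only [Prod.norm_def, Prod.fst_sub, Prod.snd_sub, sub_self, sub_zero, norm_zero,
        Real.norm_eq_abs]
      refine max_le (by positivity) (max_le this (max_le (by positivity) hsy))
    have b3 : ‖D‖ ≤ M := hd1 _ _ _ _ h1 hsp' hsy'
    rw [(rem_hasFDerivAt f hf l _).fderiv]
    refine ContinuousLinearMap.opNorm_le_bound _ (by positivity) ?_
    rintro ⟨a, b, u, v⟩
    set V : ℝ × ℝ × X × Y := (a, b, u, v) with hV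
    have n1 : ‖((a, 0, u, 0) : ℝ × ℝ × X × Y)‖ ≤ ‖V‖ := by
      simp only [hV, Prod.norm_def, norm_zero]
      refine max_le (le_max_left _ _) (max_le (by positivity) (max_le ?_ (by positivity)))
      exact (le_max_left _ _).trans ((le_max_right _ _).trans (le_max_right _ _))
    have n2 : ‖((0, b, 0, 0) : ℝ × ℝ × X × Y)‖ ≤ ‖V‖ := by
      simp only [hV, Prod.norm_def, norm_zero]
      refine max_le (by positivity) (max_le ?_ (max_le (by positivity) (by positivity)))
      exact ((le_max_left _ _).trans (le_max_right _ _))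
    have n3 : ‖((0, 0, 0, v) : ℝ × ℝ × X × Y)‖ ≤ ‖V‖ := by
      simp only [hV, Prod.norm_def, norm_zero]
      refine max_le (by positivity) (max_le (by positivity) (max_le (by positivity) ?_))
      exact (le_max_right _ _).trans ((le_max_right _ _).trans (le_max_right _ _))
    have eq : ((fderiv ℝ f (scl X Y l (w, e, x, y))).comp (scl X Y l)
          - l • (fderiv ℝ f 0).comp (prj X Y)) V
        = (D - fderiv ℝ f (w, 0, x, l • y)) (a, 0, u, 0) + l ^ 2 • D (0, b, 0, 0)
          + l • (D - fderiv ℝ f (w, 0, x, 0)) (0, 0, 0, v) := by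
      have e1 : scl X Y l V = ((a, 0, u, 0) : ℝ × ℝ × X × Y) + l ^ 2 • (0, b, 0, 0)
          + l • (0, 0, 0, v) := by
        simp [scl_apply, hV]
      have e2 : prj X Y V = (0, 0, 0, v) := by simp [prj_apply, hV]
      have e3 : scl X Y l (w, e, x, y) = (w, l ^ 2 * e, x, l • y) := by simp [scl_apply]
      rw [e3, sub_apply, smul_apply,
        ContinuousLinearMap.comp_apply, ContinuousLinearMap.comp_apply, e1, e2,
        sub_apply, sub_apply, z1, z2, map_add, map_add,
        map_smul, map_smul, smul_sub, ← hDdef]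
      abel
    rw [eq]
    have t1 := (D - fderiv ℝ f (w, 0, x, l • y)).le_of_opNorm_le_of_le b1 n1
    have t2 := D.le_of_opNorm_le_of_le b3 n2
    have t3 := (D - fderiv ℝ f (w, 0, x, 0)).le_of_opNorm_le_of_le b2 n3
    calc _ ≤ ‖(D - fderiv ℝ f (w, 0, x, l • y)) (a, 0, u, 0)‖ + ‖l ^ 2 • D (0, b, 0, 0)‖
          + ‖l • (D - fderiv ℝ f (w, 0, x, 0)) (0, 0, 0, v)‖ := norm_add₃_le
      _ = ‖(D - fderiv ℝ f (w, 0, x, l • y)) (a, 0, u, 0)‖ + l ^ 2 * ‖D (0, b, 0, 0)‖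
          + l * ‖(D - fderiv ℝ f (w, 0, x, 0)) (0, 0, 0, v)‖ := by
          rw [norm_smul, norm_smul, Real.norm_of_nonneg hl.le, Real.norm_of_nonneg (by positivity)]
      _ ≤ M * (l ^ 2 * C) * ‖V‖ + l ^ 2 * (M * ‖V‖) + l * (M * (l * C) * ‖V‖) := by gcongr
      _ = _ := by ring
  refine ⟨(2 * M * C + M) * (1 + C), by positivity, ?_⟩
  intro l hl hl1 w e x y h1 h2 h3
  have hp : ((w, e, x, y) : ℝ × ℝ × X × Y) ∈ S := ⟨h1, h2, h3⟩
  have hp0 : ((w, 0, x, 0) : ℝ × ℝ × X × Y) ∈ S := ⟨h1, by simpa using hC, by simpa using hC⟩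
  constructor
  · have h0 : rem f l (w, 0, x, 0) = 0 := by
      have : f (w, 0, x, 0) = f 0 := hinv _ _ _ _ _
      have h00 : ((0, 0, 0, 0) : ℝ × ℝ × X × Y) = 0 := rfl
      simp [rem, scl_apply, prj_apply, this, h00]
    have := hS.norm_image_sub_le_of_norm_fderiv_le
      (fun z _ => (rem_hasFDerivAt f hf l z).differentiableAt) (hder l hl hl1) hp0 hp
    rw [h0, sub_zero] at this
    refine this.trans ?_
    have : ‖((w, e, x, y) : ℝ × ℝ × X × Y) - (w, 0, x, 0)‖ ≤ C := by
      simp [Prod.norm_def, h2, h3]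
    calc _ ≤ (2 * M * C + M) * l ^ 2 * C := by gcongr
      _ ≤ (2 * M * C + M) * l ^ 2 * (1 + C) := by gcongr; linarith
      _ = _ := by ring
  · refine (hder l hl hl1 _ hp).trans ?_
    calc (2 * M * C + M) * l ^ 2 = (2 * M * C + M) * 1 * l ^ 2 := by ring
      _ ≤ _ := by gcongr; linarith
end

theorem fderiv_cut_bound {V W : Type*} [NormedAddCommGroup V] [NormedSpace ℝ V]
    [NormedAddCommGroup W] [NormedSpace ℝ W] (ψ : V → ℝ) (F : V → W) (S : Set V)
    (hS : IsClosed S) (hψ : Differentiable ℝ ψ) (hF : Differentiable ℝ F)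
    (h1 : ∀ p, |ψ p| ≤ 1) (h0 : ∀ p, p ∉ S → ψ p = 0) (Q A : ℝ) (hQ : 0 ≤ Q) (hA : 0 ≤ A)
    (hQb : ∀ p ∈ S, ‖fderiv ℝ ψ p‖ ≤ Q) (hFb : ∀ p ∈ S, ‖F p‖ ≤ A)
    (hF'b : ∀ p ∈ S, ‖fderiv ℝ F p‖ ≤ A) (p : V) :
    ‖fderiv ℝ (fun p => ψ p • F p) p‖ ≤ (1 + Q) * A := by
  rw [((hψ p).hasFDerivAt.fun_smul (hF p).hasFDerivAt).fderiv]
  by_cases hp : p ∈ S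
  · refine (norm_add_le _ _).trans ?_
    rw [norm_smul, ContinuousLinearMap.norm_smulRight_apply, Real.norm_eq_abs, add_mul]
    have := hQb p hp
    have := hFb p hp
    have := hF'b p hp
    have := h1 p
    gcongr
  · have e : ψ =ᶠ[nhds p] fun _ => 0 := by
      filter_upwards [hS.isOpen_compl.mem_nhds hp] with z hz using h0 z hz
    rw [h0 p hp, e.fderiv_eq]
    simp
    positivity

/-- unperturbed remainder vector -/
noncomputable def Fpert {X Y : Type*} [NormedAddCommGroup X] [NormedSpace ℝ X]
    [NormedAddCommGroup Y] [NormedSpace ℝ Y] (f : ℝ × ℝ × X × Y → X) (g : ℝ × ℝ × X × Y → Y)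
    (l : ℝ) (p : ℝ × ℝ × X × Y) : ℝ × ℝ × X × Y :=
  (0, 0, p.1 • (f (scl X Y l p) - f 0), l⁻¹ • rem g l p)

theorem Fpert_contDiff {X Y : Type*} [NormedAddCommGroup X] [NormedSpace ℝ X]
    [NormedAddCommGroup Y] [NormedSpace ℝ Y] (f : ℝ × ℝ × X × Y → X) (g : ℝ × ℝ × X × Y → Y)
    (hf : ContDiff ℝ 2 f) (hg : ContDiff ℝ 2 g) (l : ℝ) : ContDiff ℝ 1 (Fpert f g l) := by
  have hf1 : ContDiff ℝ 1 f := hf.of_le (by norm_num)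
  have hg1 : ContDiff ℝ 1 g := hg.of_le (by norm_num)
  unfold Fpert rem
  fun_prop

theorem Fpert_bound {X Y : Type*} [NormedAddCommGroup X] [NormedSpace ℝ X]
    [NormedAddCommGroup Y] [NormedSpace ℝ Y] (f : ℝ × ℝ × X × Y → X) (g : ℝ × ℝ × X × Y → Y)
    (hf : ContDiff ℝ 2 f) (hg : ContDiff ℝ 2 g) (C K : ℝ) (hC : 0 ≤ C) (hK : 0 ≤ K)
    (hfb : ∀ l : ℝ, 0 < l → l ≤ 1 → ∀ (w e : ℝ) (x : X) (y : Y),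
      |w| ≤ C → |e| ≤ C → ‖y‖ ≤ C →
      ‖rem f l (w, e, x, y)‖ ≤ K * l ^ 2 ∧ ‖fderiv ℝ (rem f l) (w, e, x, y)‖ ≤ K * l ^ 2)
    (hgb : ∀ l : ℝ, 0 < l → l ≤ 1 → ∀ (w e : ℝ) (x : X) (y : Y),
      |w| ≤ C → |e| ≤ C → ‖y‖ ≤ C →
      ‖rem g l (w, e, x, y)‖ ≤ K * l ^ 2 ∧ ‖fderiv ℝ (rem g l) (w, e, x, y)‖ ≤ K * l ^ 2) :
    ∃ A : ℝ, 0 ≤ A ∧ ∀ l : ℝ, 0 < l → l ≤ 1 → ∀ (w e : ℝ) (x : X) (y : Y),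
      |w| ≤ C → |e| ≤ C → ‖y‖ ≤ C →
      ‖Fpert f g l (w, e, x, y)‖ ≤ A * l ∧ ‖fderiv ℝ (Fpert f g l) (w, e, x, y)‖ ≤ A * l := by
  set T := (fderiv ℝ f 0).comp (prj X Y) with hT
  set N := ‖fderiv ℝ f 0‖ with hN
  have hN0 : 0 ≤ N := norm_nonneg _
  have hT0 : 0 ≤ ‖T‖ := norm_nonneg _
  refine ⟨C * (K + ‖T‖) + (1 + C) * (K + N * C) + K, by positivity, ?_⟩
  intro l hl hl1 w e x y h1 h2 h3
  obtain ⟨f1, f2⟩ := hfb l hl hl1 w e x y h1 h2 h3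
  obtain ⟨g1, g2⟩ := hgb l hl hl1 w e x y h1 h2 h3
  set p : ℝ × ℝ × X × Y := (w, e, x, y) with hp
  have hll : l ^ 2 ≤ l := by nlinarith
  have hw : ‖p.1‖ ≤ C := h1
  have hu : ∀ z, f (scl X Y l z) - f 0 = rem f l z + l • T z := by
    intro z; simp [rem, hT]
  have hTp : ‖T p‖ ≤ N * C := by
    have : T p = fderiv ℝ f 0 (0, 0, 0, y) := by simp [hT, prj_apply, hp]
    rw [this]
    refine ContinuousLinearMap.le_of_opNorm_le_of_le _ le_rfl ?_
    simpa [Prod.norm_def] using h3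
  have ub : ‖rem f l p + l • T p‖ ≤ (K + N * C) * l := by
    refine (norm_add_le _ _).trans ?_
    rw [norm_smul, Real.norm_of_nonneg hl.le]
    calc _ ≤ K * l + l * (N * C) := by
            gcongr
            exact f1.trans (by gcongr)
      _ = _ := by ring
  have ub' : ‖fderiv ℝ (rem f l) p + l • T‖ ≤ (K + ‖T‖) * l := by
    refine (norm_add_le _ _).trans ?_
    rw [norm_smul, Real.norm_of_nonneg hl.le]
    calc _ ≤ K * l + l * ‖T‖ := by
            gcongr
            exact f2.trans (by gcongr)
      _ = _ := by ring
  have gl : ∀ a : ℝ, a ≤ K * l ^ 2 → l⁻¹ * a ≤ K * l := by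
    intro a ha
    rw [inv_mul_le_iff₀ hl]
    calc a ≤ _ := ha
      _ = _ := by ring
  have hFe : Fpert f g l = fun z => (0, 0, z.1 • (rem f l z + l • T z), l⁻¹ • rem g l z) := by
    funext z; simp [Fpert, hu]
  have q1 : 0 ≤ C * (K + ‖T‖) * l := by positivity
  have q2 : 0 ≤ (K + N * C) * l := by positivity
  have q3 : 0 ≤ C * (K + N * C) * l := by positivity
  have q4 : 0 ≤ K * l := by positivity
  constructor
  · rw [hFe]
    simp only [Prod.norm_def, norm_zero, norm_smul]
    refine max_le (by positivity) (max_le (by positivity) (max_le ?_ ?_))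
    · calc _ ≤ C * ((K + N * C) * l) := by gcongr
        _ ≤ _ := by linarith
    · rw [norm_inv, Real.norm_of_nonneg hl.le]
      exact (gl _ g1).trans (by linarith)
  · have d1 := (rem_hasFDerivAt f hf l p).differentiableAt.hasFDerivAt
    have d2 := (rem_hasFDerivAt g hg l p).differentiableAt.hasFDerivAt
    have d3 : HasFDerivAt (fun z => rem f l z + l • T z) (fderiv ℝ (rem f l) p + l • T) p :=
      d1.add (T.hasFDerivAt.const_smul l)
    have d4 := (hasFDerivAt_fst (𝕜 := ℝ) (p := p)).smul d3
    have d5 := (hasFDerivAt_const (0:ℝ) p).prodMk ((hasFDerivAt_const (0:ℝ) p).prodMk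
      (d4.prodMk (d2.const_smul l⁻¹)))
    have d6 := d5.fderiv
    rw [hFe]
    erw [d6]
    rw [ContinuousLinearMap.opNorm_prod, Prod.norm_def, ContinuousLinearMap.opNorm_prod,
      Prod.norm_def, ContinuousLinearMap.opNorm_prod, Prod.norm_def]
    simp only [norm_zero]
    refine max_le (by positivity) (max_le (by positivity) (max_le ?_ ?_))
    · refine (norm_add_le _ _).trans ?_
      rw [norm_smul, ContinuousLinearMap.norm_smulRight_apply]
      have := ContinuousLinearMap.norm_fst_le ℝ ℝ (ℝ × X × Y)
      calc _ ≤ C * ((K + ‖T‖) * l) + 1 * ((K + N * C) * l) := by gcongr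
        _ ≤ _ := by linarith
    · rw [norm_smul, norm_inv, Real.norm_of_nonneg hl.le]
      exact (gl _ g2).trans (by linarith)

/-- Corollary 2.3: `G_λ` is a surjective `C¹`-diffeomorphism for all small `λ`. -/
theorem stmt2 (k₁ k₂ : ℕ) (r₁ : ℝ) (hr₁ : 0 < r₁)
    (α : ℝ → ℝ → Euc k₁ → Euc k₂ → Euc k₁)
    (β : ℝ → ℝ → Euc k₁ → Euc k₂ → Euc k₂)
    (hαC2 : ContDiff ℝ 2 (fun p : ℝ × ℝ × Euc k₁ × Euc k₂ => α p.1 p.2.1 p.2.2.1 p.2.2.2))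
    (hβC2 : ContDiff ℝ 2 (fun p : ℝ × ℝ × Euc k₁ × Euc k₂ => β p.1 p.2.1 p.2.2.1 p.2.2.2))
    (hA1 : ∀ C : ℝ, ∃ M : ℝ, ∀ (ω ε : ℝ) (x : Euc k₁) (y : Euc k₂),
      |ω| ≤ C → |ε| ≤ C → ‖y‖ ≤ C → ∀ i : ℕ, i ≤ 2 →
        ‖iteratedFDeriv ℝ i (fun p : ℝ × ℝ × Euc k₁ × Euc k₂ => α p.1 p.2.1 p.2.2.1 p.2.2.2)
            (ω, ε, x, y)‖ ≤ M ∧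
        ‖iteratedFDeriv ℝ i (fun p : ℝ × ℝ × Euc k₁ × Euc k₂ => β p.1 p.2.1 p.2.2.1 p.2.2.2)
            (ω, ε, x, y)‖ ≤ M)
    (hA2α : ∀ (ω ω' : ℝ) (x x' : Euc k₁) (y : Euc k₂), α ω 0 x y = α ω' 0 x' y)
    (hA2β : ∀ (ω ω' : ℝ) (x x' : Euc k₁) (y : Euc k₂), β ω 0 x y = β ω' 0 x' y)
    (hA20 : β 0 0 0 0 = 0)
    (hA3inv : ∃ Beq : Euc k₂ ≃L[ℝ] Euc k₂,
      (Beq : Euc k₂ →L[ℝ] Euc k₂) = fderiv ℝ (fun y : Euc k₂ => β 0 0 0 y) 0)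
    (q : ℝ) (hq0 : 0 ≤ q) (hq1 : q < 1)
    (hA3q : ∀ y₁ y₂ : Euc k₂, ‖y₁‖ ≤ r₁ → ‖y₂‖ ≤ r₁ →
      ‖β 0 0 0 y₁ - β 0 0 0 y₂‖ ≤ q * ‖y₁ - y₂‖)
    (Ψ : ℝ → ℝ → Euc k₂ → ℝ)
    (hΨC1 : ContDiff ℝ 1 (fun p : ℝ × ℝ × Euc k₂ => Ψ p.1 p.2.1 p.2.2))
    (hΨ01 : ∀ (ω ε : ℝ) (y : Euc k₂), Ψ ω ε y ∈ Icc (0:ℝ) 1)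
    (hΨ1 : ∀ (ω ε : ℝ) (y : Euc k₂),
      ω ∈ Icc (0:ℝ) 1 → ε ∈ Ioo (-(r₁ / 2)) (r₁ / 2) → ‖y‖ ≤ r₁ / 2 → Ψ ω ε y = 1)
    (hΨ0 : ∀ (ω ε : ℝ) (y : Euc k₂),
      ¬(ω ∈ Icc (-1:ℝ) 2 ∧ ε ∈ Ioo (-r₁) r₁ ∧ ‖y‖ ≤ r₁) → Ψ ω ε y = 0) :
    ∃ l₀ : ℝ, 0 < l₀ ∧ l₀ ≤ 1 ∧ ∀ l : ℝ, 0 < l → l ≤ l₀ →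
      Function.Bijective (Glam α β Ψ l) ∧
      ContDiff ℝ 1 (Glam α β Ψ l) ∧
      ContDiff ℝ 1 (Function.invFun (Glam α β Ψ l)) := by
  obtain ⟨Beq, hBeq⟩ := hA3inv
  set f : ℝ × ℝ × Euc k₁ × Euc k₂ → Euc k₁ := fun p => α p.1 p.2.1 p.2.2.1 p.2.2.2 with hfdef
  set g : ℝ × ℝ × Euc k₁ × Euc k₂ → Euc k₂ := fun p => β p.1 p.2.1 p.2.2.1 p.2.2.2 with hgdef
  have hC : (0:ℝ) ≤ 2 + r₁ := by positivity
  obtain ⟨M, hM⟩ := hA1 (2 + r₁)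
  obtain ⟨Kf, hKf0, hKf⟩ := rem_bound f hαC2 (fun w w' x x' y => hA2α w w' x x' y) (2 + r₁) hC
    ⟨M, fun w e x y h1 h2 h3 i hi => (hM w e x y h1 h2 h3 i hi).1⟩
  obtain ⟨Kg, hKg0, hKg⟩ := rem_bound g hβC2 (fun w w' x x' y => hA2β w w' x x' y) (2 + r₁) hC
    ⟨M, fun w e x y h1 h2 h3 i hi => (hM w e x y h1 h2 h3 i hi).2⟩
  have mono1 : ∀ (a l : ℝ), a ≤ Kf * l ^ 2 → a ≤ (Kf + Kg) * l ^ 2 := by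
    intro a l h; nlinarith [sq_nonneg l]
  have mono2 : ∀ (a l : ℝ), a ≤ Kg * l ^ 2 → a ≤ (Kf + Kg) * l ^ 2 := by
    intro a l h; nlinarith [sq_nonneg l]
  obtain ⟨A, hA0, hA⟩ := Fpert_bound f g hαC2 hβC2 (2 + r₁) (Kf + Kg) hC (by positivity)
    (fun l hl hl1 w e x y h1 h2 h3 => ⟨mono1 _ _ (hKf l hl hl1 w e x y h1 h2 h3).1,
      mono1 _ _ (hKf l hl hl1 w e x y h1 h2 h3).2⟩)
    (fun l hl hl1 w e x y h1 h2 h3 => ⟨mono2 _ _ (hKg l hl hl1 w e x y h1 h2 h3).1,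
      mono2 _ _ (hKg l hl hl1 w e x y h1 h2 h3).2⟩)
  -- the linear part
  let L : (ℝ × ℝ × Euc k₁ × Euc k₂) ≃L[ℝ] (ℝ × ℝ × Euc k₁ × Euc k₂) :=
    (ContinuousLinearEquiv.refl ℝ ℝ).prodCongr ((ContinuousLinearEquiv.refl ℝ ℝ).prodCongr
      ((ContinuousLinearEquiv.refl ℝ (Euc k₁)).prodCongr Beq))
  have hL : ∀ p, L p = (p.1, p.2.1, p.2.2.1, Beq p.2.2.2) := fun p => rfl
  obtain ⟨c, hc0, hc⟩ := approx_bij L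
  -- the cutoff
  let ψ : ℝ × ℝ × Euc k₁ × Euc k₂ → ℝ := fun p => Ψ p.1 p.2.1 p.2.2.2
  let S : Set (ℝ × ℝ × Euc k₁ × Euc k₂) :=
    {p | |p.1| ≤ 2 + r₁ ∧ |p.2.1| ≤ 2 + r₁ ∧ ‖p.2.2.2‖ ≤ 2 + r₁}
  have hSc : IsClosed S := by
    have e : S = Metric.closedBall (0:ℝ) (2 + r₁) ×ˢ (Metric.closedBall (0:ℝ) (2 + r₁) ×ˢ
        ((univ : Set (Euc k₁)) ×ˢ Metric.closedBall (0:Euc k₂) (2 + r₁))) := by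
      ext p; simp [S]
    rw [e]
    exact Metric.isClosed_closedBall.prod (Metric.isClosed_closedBall.prod
      (isClosed_univ.prod Metric.isClosed_closedBall))
  let π : (ℝ × ℝ × Euc k₁ × Euc k₂) →L[ℝ] (ℝ × ℝ × Euc k₂) :=
    (ContinuousLinearMap.id ℝ ℝ).prodMap ((ContinuousLinearMap.id ℝ ℝ).prodMap
      (ContinuousLinearMap.snd ℝ (Euc k₁) (Euc k₂)))
  have hψπ : ψ = (fun p : ℝ × ℝ × Euc k₂ => Ψ p.1 p.2.1 p.2.2) ∘ π := rfl
  have hψC : ContDiff ℝ 1 ψ := by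
    rw [hψπ]; exact hΨC1.comp π.contDiff
  obtain ⟨Q, hQ⟩ := (((isCompact_closedBall (0:ℝ) (2 + r₁)).prod
    ((isCompact_closedBall (0:ℝ) (2 + r₁)).prod
      (isCompact_closedBall (0:Euc k₂) (2 + r₁))))).exists_bound_of_continuousOn
    (hΨC1.continuous_fderiv (by norm_num)).continuousOn
  have hQ0 : 0 ≤ Q := (norm_nonneg _).trans (hQ 0 (by simp [hC]))
  have hψb : ∀ p ∈ S, ‖fderiv ℝ ψ p‖ ≤ Q * ‖π‖ := by
    intro p hp
    rw [hψπ, fderiv_comp _ (hΨC1.differentiable (by norm_num) _) π.differentiableAt,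
      ContinuousLinearMap.fderiv]
    refine (ContinuousLinearMap.opNorm_comp_le _ _).trans ?_
    gcongr
    refine hQ _ ?_
    simpa [π, S] using hp
  have hψ1 : ∀ p, |ψ p| ≤ 1 := fun p => by
    have := hΨ01 p.1 p.2.1 p.2.2.2
    exact abs_le.2 ⟨by linarith [this.1], this.2⟩
  have hψ0 : ∀ p, p ∉ S → ψ p = 0 := by
    intro p hp
    apply hΨ0
    rintro ⟨h1, h2, h3⟩
    exact hp ⟨abs_le.2 ⟨by linarith [h1.1], by linarith [h1.2]⟩,
      abs_le.2 ⟨by linarith [h2.1], by linarith [h2.2]⟩, by linarith⟩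
  set Q' := Q * ‖π‖ with hQ'
  have hQ'0 : 0 ≤ Q' := by positivity
  refine ⟨min 1 (c / ((1 + Q') * A + 1)), by positivity, min_le_left _ _, ?_⟩
  intro l hl hll
  have hl1 : l ≤ 1 := hll.trans (min_le_left _ _)
  have hlc : (1 + Q') * (A * l) ≤ c := by
    have h := hll.trans (min_le_right _ _)
    rw [le_div_iff₀ (by positivity)] at h
    nlinarith
  have hFC := Fpert_contDiff f g hαC2 hβC2 l
  obtain ⟨h, hh, hhs⟩ := hc (fun p => ψ p • Fpert f g l p) (hψC.smul hFC) (fun p =>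
    (fderiv_cut_bound ψ (Fpert f g l) S hSc (hψC.differentiable (by norm_num))
      (hFC.differentiable (by norm_num)) hψ1 hψ0 Q' (A * l) hQ'0 (by positivity) hψb
      (fun p hp => (hA l hl hl1 _ _ _ _ hp.1 hp.2.1 hp.2.2).1)
      (fun p hp => (hA l hl hl1 _ _ _ _ hp.1 hp.2.1 hp.2.2).2) p).trans hlc)
  have hhC : ContDiff ℝ 1 h := by
    rw [show (h : _ → _) = _ from funext hh]
    exact L.contDiff.add (hψC.smul hFC)
  have hB : ∀ v, fderiv ℝ (fun y : Euc k₂ => β 0 0 0 y) 0 v = fderiv ℝ g 0 (0, 0, 0, v) := by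
    intro v
    have hd : Differentiable ℝ g := hβC2.differentiable (by norm_num)
    let j : Euc k₂ →L[ℝ] (ℝ × ℝ × Euc k₁ × Euc k₂) :=
      (0 : Euc k₂ →L[ℝ] ℝ).prod ((0 : Euc k₂ →L[ℝ] ℝ).prod ((0 : Euc k₂ →L[ℝ] Euc k₁).prod
        (ContinuousLinearMap.id ℝ (Euc k₂))))
    have e : (fun y : Euc k₂ => β 0 0 0 y) = g ∘ j := rfl
    have e0 : j 0 = 0 := map_zero j
    rw [e, fderiv_comp _ (hd _) j.differentiableAt, ContinuousLinearMap.fderiv, e0]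
    rfl
  let a0 := α 0 0 0 0
  let D : ℝ × ℝ × Euc k₁ × Euc k₂ → ℝ × ℝ × Euc k₁ × Euc k₂ := fun p => (l * p.1, p.2)
  let Di : ℝ × ℝ × Euc k₁ × Euc k₂ → ℝ × ℝ × Euc k₁ × Euc k₂ := fun p => (l⁻¹ * p.1, p.2)
  let T : ℝ × ℝ × Euc k₁ × Euc k₂ → ℝ × ℝ × Euc k₁ × Euc k₂ :=
    fun p => (l⁻¹ * p.1, p.2.1, p.2.2.1 + p.1 • a0, p.2.2.2)
  let Ti : ℝ × ℝ × Euc k₁ × Euc k₂ → ℝ × ℝ × Euc k₁ × Euc k₂ :=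
    fun p => (l * p.1, p.2.1, p.2.2.1 - (l * p.1) • a0, p.2.2.2)
  have hl0 : l ≠ 0 := hl.ne'
  have DDi : ∀ p, D (Di p) = p := fun p => by simp [D, Di, hl0]
  have DiD : ∀ p, Di (D p) = p := fun p => by simp [D, Di, hl0]
  have TTi : ∀ p, T (Ti p) = p := fun p => by simp [T, Ti, hl0]
  have TiT : ∀ p, Ti (T p) = p := fun p => by simp [T, Ti, hl0]
  have hG : Glam α β Ψ l = fun p => T (h (D p)) := by
    funext p
    obtain ⟨w, e, x, y⟩ := p
    rw [hh, hL]
    have hg0 : g 0 = 0 := hA20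
    have hf0 : f 0 = a0 := rfl
    have hBy : Beq y = fderiv ℝ g 0 (0, 0, 0, y) := by
      rw [← hB, ← hBeq]; rfl
    have e1 : l⁻¹ • rem g l (l * w, e, x, y)
        = l⁻¹ • β (l * w) (l ^ 2 * e) x (l • y) - Beq y := by
      simp [rem, scl_apply, prj_apply, hg0, smul_sub, smul_smul, hl0, hBy]
      rfl
    have e2 : f (scl _ _ l (l * w, e, x, y)) = α (l * w) (l ^ 2 * e) x (l • y) := by
      simp [scl_apply, f]
    have e3 : Fpert f g l (D (w, e, x, y)) = (0, 0,
        (l * w) • (α (l * w) (l ^ 2 * e) x (l • y) - a0),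
        l⁻¹ • β (l * w) (l ^ 2 * e) x (l • y) - Beq y) := by
      simp only [Fpert, D]
      rw [e1, e2, hf0]
    rw [e3]
    simp only [Glam, tAl, tBl, T, D, hB, ← hBy, ψ]
    simp [hl0]
    simp only [a0]
    abel
  have hTC : ContDiff ℝ 1 T := by fun_prop
  have hTiC : ContDiff ℝ 1 Ti := by fun_prop
  have hDC : ContDiff ℝ 1 D := by fun_prop
  have hDiC : ContDiff ℝ 1 Di := by fun_prop
  have left : Function.LeftInverse (fun p => Di (h.symm (Ti p))) (Glam α β Ψ l) := by
    intro p; rw [hG]; simp only [TiT, Homeomorph.symm_apply_apply, DiD]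
  have right : Function.RightInverse (fun p => Di (h.symm (Ti p))) (Glam α β Ψ l) := by
    intro p; rw [hG]; simp only [DDi, Homeomorph.apply_symm_apply, TTi]
  refine ⟨⟨left.injective, right.surjective⟩, ?_, ?_⟩
  · rw [hG]; exact hTC.comp (hhC.comp hDC)
  · rw [Function.invFun_eq_of_injective_of_rightInverse left.injective right]
    exact hDiC.comp (hhs.comp hTiC)
end
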